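/- Let a = s + c be a pointed rational affine cone with rational vertex s, and let v_1,…,v_k be rational generators of the edges of the cone c. Then the functions ξ ↦ (∏_{i=1}^k ⟨ξ,v_i⟩) · I(s+c)(ξ) and ξ ↦ (∏_{i=1}^k ⟨ξ,v_i⟩) · S(s+c)(ξ) are analytic in a neighborhood of 0 in V*. -/

import Mathlib

open MeasureTheory Filter Topology Set
open scoped RealInnerProductSpace Pointwise BigOperators

noncomputable section

/-- the ambient rational vector space: `ℝ^d` with the standard inner product, which is used
to identify `V` with its dual space `V^*`. -/
abbrev Vd (d : ℕ) := EuclideanSpace ℝ (Fin d)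

variable {d : ℕ}

/-- the duality pairing `⟨ξ, x⟩` between `V^*` and `V`, realized by the standard inner
product of `ℝ^d`. -/
def pairE {d : ℕ} (ξ x : Vd d) : ℝ := @inner ℝ _ _ ξ x

/-- `Λ` is a lattice of its span: it is generated by finitely many `ℝ`-independent vectors. -/
def IsLatticeSub (Λ : AddSubgroup (Vd d)) : Prop :=
  ∃ (k : ℕ) (v : Fin k → Vd d), LinearIndependent ℝ v ∧
    Λ = AddSubgroup.closure (Set.range v)

/-- `Λ` is a full-rank lattice in `ℝ^d`. -/
def IsFullLattice (Λ : AddSubgroup (Vd d)) : Prop :=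
  IsLatticeSub Λ ∧ Submodule.span ℝ (Λ : Set (Vd d)) = ⊤

/-- `x` is a rational point with respect to the lattice `Λ`. -/
def IsRatPoint (Λ : AddSubgroup (Vd d)) (x : Vd d) : Prop :=
  ∃ q : ℤ, q ≠ 0 ∧ (q : ℝ) • x ∈ Λ

/-- viewing `φ ∈ V` as a linear functional via the standard pairing, it takes integer values
on `Λ`, i.e. it belongs to the dual lattice. -/
def IsDualIntegral (Λ : AddSubgroup (Vd d)) (φ : Vd d) : Prop :=
  ∀ x ∈ Λ, ∃ n : ℤ, (pairE (φ) (x)) = (n : ℝ)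

/-- a rational polyhedron (inside the span of `Λ`): a finite intersection of half-spaces
bounded by rational affine hyperplanes. -/
def IsRatPolyhedron (Λ : AddSubgroup (Vd d)) (P : Set (Vd d)) : Prop :=
  ∃ (n : ℕ) (φ : Fin n → Vd d) (c : Fin n → ℚ),
    (∀ i, IsDualIntegral Λ (φ i)) ∧
    P = {x | x ∈ Submodule.span ℝ (Λ : Set (Vd d)) ∧ ∀ i, (pairE (φ i) x) ≤ (c i : ℝ)}

/-- the set `P` contains a straight (affine) line. -/
def ContainsLine (P : Set (Vd d)) : Prop :=
  ∃ x u : Vd d, u ≠ 0 ∧ ∀ t : ℝ, x + t • u ∈ P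

/-- equality of meromorphic-type functions near `0`: they agree near `0` outside a closed
set with empty interior (the polar set). -/
def MeroEqAt0 (f g : Vd d → ℝ) : Prop :=
  ∃ Z : Set (Vd d), IsClosed Z ∧ interior Z = ∅ ∧
    ∀ᶠ ξ in 𝓝 (0 : Vd d), ξ ∉ Z → f ξ = g ξ

/-- `g` is analytic at `0` and its Taylor coefficients are rational with respect to an
integral basis (i.e. the coefficients take rational values on dual-lattice vectors). -/
def HasRatSeriesAt0 (Λ : AddSubgroup (Vd d)) (g : Vd d → ℝ) : Prop :=
  ∃ p : FormalMultilinearSeries ℝ (Vd d) ℝ, HasFPowerSeriesAt g p 0 ∧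
    ∀ (n : ℕ) (w : Fin n → Vd d), (∀ i, IsDualIntegral Λ (w i)) →
      ∃ q : ℚ, (p n) w = (q : ℝ)

/-- `f` is meromorphic near `0` with rational Taylor coefficients: near `0` it is a quotient
of two analytic functions with rational Taylor coefficients. -/
def RatMeromorphicAt0 (Λ : AddSubgroup (Vd d)) (f : Vd d → ℝ) : Prop :=
  ∃ g h : Vd d → ℝ, HasRatSeriesAt0 Λ g ∧ HasRatSeriesAt0 Λ h ∧
    (¬ ∀ᶠ ξ in 𝓝 (0 : Vd d), h ξ = 0) ∧
    (∀ᶠ ξ in 𝓝 (0 : Vd d), h ξ ≠ 0 → f ξ * h ξ = g ξ)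

/-- `m` is the canonical Lebesgue measure carried by the rational affine subspace `A`,
normalized so that a fundamental parallelepiped of the lattice `Λ ∩ lin(A)` has volume `1`:
it is the image of the standard Lebesgue measure under a `ℤ`-basis parametrization. -/
def IsCanonicalMeasure (Λ : AddSubgroup (Vd d)) (A : Set (Vd d)) (m : Measure (Vd d)) : Prop :=
  ∃ (k : ℕ) (x₀ : Vd d) (v : Fin k → Vd d),
    x₀ ∈ A ∧ (∀ i, v i ∈ Λ) ∧ LinearIndependent ℝ v ∧
    A = {x | ∃ t : Fin k → ℝ, x = x₀ + ∑ i, t i • v i} ∧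
    (∀ y ∈ Λ, y ∈ Submodule.span ℝ (Set.range v) →
      ∃ c : Fin k → ℤ, y = ∑ i, (c i : ℝ) • v i) ∧
    m = Measure.map (fun t : Fin k → ℝ => x₀ + ∑ i, t i • v i) volume

/-- the characterizing properties of the map `I`: it sends rational polyhedra to meromorphic
functions with rational coefficients, vanishes on polyhedra containing lines, and is given by
`∫_P e^{⟨ξ,x⟩} dm_{<P>}(x)` wherever this integral converges. -/
def IsIMap (Λ : AddSubgroup (Vd d)) (I : Set (Vd d) → Vd d → ℝ) : Prop :=
  (∀ P, IsRatPolyhedron Λ P → RatMeromorphicAt0 Λ (I P)) ∧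
  (∀ P, IsRatPolyhedron Λ P → ContainsLine P → ∀ ξ, I P ξ = 0) ∧
  (∀ P, IsRatPolyhedron Λ P → ∀ m : Measure (Vd d),
    IsCanonicalMeasure Λ ((affineSpan ℝ P : AffineSubspace ℝ (Vd d)) : Set (Vd d)) m →
    ∀ ξ : Vd d, IntegrableOn (fun x => Real.exp (pairE (ξ) (x))) P m →
      I P ξ = ∫ x in P, Real.exp (pairE (ξ) (x)) ∂m)

/-- the characterizing properties of the map `S`: it sends rational polyhedra to meromorphic
functions with rational coefficients, vanishes on polyhedra containing lines, and is given by
`∑_{x ∈ P ∩ Λ} e^{⟨ξ,x⟩}` wherever this sum converges absolutely. -/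
def IsSMap (Λ : AddSubgroup (Vd d)) (S : Set (Vd d) → Vd d → ℝ) : Prop :=
  (∀ P, IsRatPolyhedron Λ P → RatMeromorphicAt0 Λ (S P)) ∧
  (∀ P, IsRatPolyhedron Λ P → ContainsLine P → ∀ ξ, S P ξ = 0) ∧
  (∀ P, IsRatPolyhedron Λ P → ∀ ξ : Vd d,
    Summable (fun x : ↥(P ∩ (Λ : Set (Vd d))) => Real.exp (pairE ξ (x : Vd d))) →
      S P ξ = ∑' x : ↥(P ∩ (Λ : Set (Vd d))), Real.exp (pairE ξ (x : Vd d)))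

/-- `F` is a (nonempty, exposed) face of the convex set `P`. -/
def IsFaceOf (P F : Set (Vd d)) : Prop :=
  F.Nonempty ∧ ∃ φ : Vd d, F = {x ∈ P | ∀ y ∈ P, (pairE (φ) (y)) ≤ (pairE (φ) (x))}

/-- `v` is a vertex of `P`. -/
def IsVertexOf (P : Set (Vd d)) (v : Vd d) : Prop := IsFaceOf P {v}

/-- the cone of feasible directions of `P` along the face `F` (computed at a point of the
relative interior of `F`). -/
def feasibleCone (P F : Set (Vd d)) : Set (Vd d) :=
  {u | ∃ x ∈ intrinsicInterior ℝ F, ∃ ε : ℝ, 0 < ε ∧ ∀ t : ℝ, 0 < t → t ≤ ε → x + t • u ∈ P}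

/-- the supporting cone `<F> + c(P,F)` of `P` along its face `F`. -/
def suppCone (P F : Set (Vd d)) : Set (Vd d) :=
  {z | ∃ a ∈ (affineSpan ℝ F : Set (Vd d)), ∃ u ∈ feasibleCone P F, z = a + u}

/-- the recession cone (cone of directions) of a convex set. -/
def recCone (P : Set (Vd d)) : Set (Vd d) :=
  {u | ∀ x ∈ P, ∀ t : ℝ, 0 ≤ t → x + t • u ∈ P}

/-- a rational affine cone with respect to the lattice `Λ`: a rational translate of a cone
generated by finitely many lattice vectors. -/
def IsRatAffineCone (Λ : AddSubgroup (Vd d)) (a : Set (Vd d)) : Prop :=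
  ∃ (s : Vd d) (n : ℕ) (v : Fin n → Vd d), IsRatPoint Λ s ∧ (∀ i, v i ∈ Λ) ∧
    a = {x | ∃ t : Fin n → ℝ, (∀ i, 0 ≤ t i) ∧ x = s + ∑ i, t i • v i}

/-- a rational (convex polyhedral) cone with vertex at the origin. -/
def IsRatCone (Λ : AddSubgroup (Vd d)) (c : Set (Vd d)) : Prop :=
  ∃ (n : ℕ) (v : Fin n → Vd d), (∀ i, v i ∈ Λ) ∧
    c = {x | ∃ t : Fin n → ℝ, (∀ i, 0 ≤ t i) ∧ x = ∑ i, t i • v i}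

/-- `Q` is a rational scalar product: a symmetric positive definite bilinear form taking
rational values on lattice vectors. -/
def IsRatInner (Λ : AddSubgroup (Vd d)) (Q : Vd d →ₗ[ℝ] Vd d →ₗ[ℝ] ℝ) : Prop :=
  (∀ x y, Q x y = Q y x) ∧ (∀ x : Vd d, x ≠ 0 → 0 < Q x x) ∧
  (∀ x ∈ Λ, ∀ y ∈ Λ, ∃ q : ℚ, Q x y = (q : ℝ))

/-- `π` realizes the quotient map `V → V/L` as the `Q`-orthogonal projection onto the
`Q`-orthogonal complement of `L`. -/
def IsQCoproj (Q : Vd d →ₗ[ℝ] Vd d →ₗ[ℝ] ℝ) (L : Submodule ℝ (Vd d))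
    (π : Vd d →ₗ[ℝ] Vd d) : Prop :=
  (∀ x, x - π x ∈ L) ∧ (∀ x : Vd d, ∀ y ∈ L, Q (π x) y = 0)

/-- `Λ'` is the lattice of a rational quotient space of `(V, Λ)`, realized inside `V` via the
`Q`-orthogonal projection along a rational subspace. -/
def IsQuotLattice (Q : Vd d →ₗ[ℝ] Vd d →ₗ[ℝ] ℝ) (Λ Λ' : AddSubgroup (Vd d)) : Prop :=
  ∃ (L : Submodule ℝ (Vd d)) (π : Vd d →ₗ[ℝ] Vd d),
    Submodule.span ℝ ((L : Set (Vd d)) ∩ (Λ : Set (Vd d))) = L ∧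
    IsQCoproj Q L π ∧ Λ' = AddSubgroup.map π.toAddMonoidHom Λ

/-- a family of maps `I` indexed by the rational quotient spaces of `(V,Λ)`, each member
satisfying the characterizing properties of the integral generating function. -/
def IsIFamily (Q : Vd d →ₗ[ℝ] Vd d →ₗ[ℝ] ℝ) (Λ : AddSubgroup (Vd d))
    (I : AddSubgroup (Vd d) → Set (Vd d) → Vd d → ℝ) : Prop :=
  ∀ Λ', IsQuotLattice Q Λ Λ' → IsIMap Λ' (I Λ')

/-- a family of maps `S` indexed by the rational quotient spaces of `(V,Λ)`, each member
satisfying the characterizing properties of the lattice-point generating function. -/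
def IsSFamily (Q : Vd d →ₗ[ℝ] Vd d →ₗ[ℝ] ℝ) (Λ : AddSubgroup (Vd d))
    (S : AddSubgroup (Vd d) → Set (Vd d) → Vd d → ℝ) : Prop :=
  ∀ Λ', IsQuotLattice Q Λ Λ' → IsSMap Λ' (S Λ')

/-- the defining properties (a),(b),(c) of the family `μ` of Berline--Vergne:
each `μ(a)` is meromorphic with rational coefficients near `0`, `μ_{0}({0}) = 1`, and for
every pointed rational affine cone `a` in a rational quotient `W` of `V` one has
`S(a) = ∑_{f ∈ F(a)} μ(t(a,f)) I(f)`, where the transverse cone `t(a,f)` is realized inside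
`V` by the `Q`-orthogonal projection `π F` along `lin(f)`, and functions on quotient duals
are extended by `Q`-orthogonal projection. -/
def IsMuCore (Λ : AddSubgroup (Vd d)) (Q : Vd d →ₗ[ℝ] Vd d →ₗ[ℝ] ℝ)
    (I S μ : AddSubgroup (Vd d) → Set (Vd d) → Vd d → ℝ) : Prop :=
  (∀ Λ', IsQuotLattice Q Λ Λ' → ∀ a, IsRatAffineCone Λ' a → ¬ ContainsLine a →
      RatMeromorphicAt0 Λ' (μ Λ' a)) ∧
  (∀ ξ, μ ⊥ ({0} : Set (Vd d)) ξ = 1) ∧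
  (∀ Λ', IsQuotLattice Q Λ Λ' → ∀ a, IsRatAffineCone Λ' a → ¬ ContainsLine a →
    ∀ π : Set (Vd d) → (Vd d →ₗ[ℝ] Vd d),
      (∀ F, IsFaceOf a F → IsQCoproj Q (affineSpan ℝ F).direction (π F)) →
      MeroEqAt0 (S Λ' a)
        (fun ξ => ∑ᶠ F ∈ {F | IsFaceOf a F},
          μ (AddSubgroup.map (π F).toAddMonoidHom Λ') ((π F) '' suppCone a F) ξ
            * I Λ' F ξ))

/-- the family `μ`, extended by `μ(a) = 0` on cones containing a straight line. -/
def IsMuFamily (Λ : AddSubgroup (Vd d)) (Q : Vd d →ₗ[ℝ] Vd d →ₗ[ℝ] ℝ)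
    (I S μ : AddSubgroup (Vd d) → Set (Vd d) → Vd d → ℝ) : Prop :=
  IsMuCore Λ Q I S μ ∧
  (∀ Λ', IsQuotLattice Q Λ Λ' → ∀ a, IsRatAffineCone Λ' a → ContainsLine a →
    ∀ ξ, μ Λ' a ξ = 0)

/-- the trace pairing of two `n`-multilinear forms on `ℝ^d`, computed in the standard basis. -/
def multiPair {n : ℕ} (p q : ContinuousMultilinearMap ℝ (fun _ : Fin n => Vd d) ℝ) : ℝ :=
  ∑ ι : Fin n → Fin d,
    p (fun j => (EuclideanSpace.basisFun (Fin d) ℝ) (ι j)) *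
    q (fun j => (EuclideanSpace.basisFun (Fin d) ℝ) (ι j))

/-- the action on `h` of the infinite-order constant-coefficient differential operator whose
symbol has Taylor series `p` at `0`; on polynomials `h` the sum is finite.  Its defining
property is `D(Φ)e^{⟨ξ,·⟩} = Φ(ξ)e^{⟨ξ,·⟩}`. -/
def DOp (p : FormalMultilinearSeries ℝ (Vd d) ℝ) (h : Vd d → ℝ) (x : Vd d) : ℝ :=
  ∑ᶠ n : ℕ, multiPair (p n) (iteratedFDeriv ℝ n h x)

/-- `h` is a polynomial function on `ℝ^d`. -/
def IsPolyFun (h : Vd d → ℝ) : Prop :=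
  ∃ p : MvPolynomial (Fin d) ℝ, ∀ x : Vd d, h x = MvPolynomial.eval (fun i => x i) p

/-- `h` is a polynomial function of degree at most `r` on `ℝ^d`. -/
def IsPolyFunOfDeg (h : Vd d → ℝ) (r : ℕ) : Prop :=
  ∃ p : MvPolynomial (Fin d) ℝ, p.totalDegree ≤ r ∧
    ∀ x : Vd d, h x = MvPolynomial.eval (fun i => x i) p

end

open MeasureTheory Filter Topology Set
open scoped RealInnerProductSpace Pointwise BigOperators
noncomputable section

/-- the cone generated by a finite family. -/
def coneOf {d k : ℕ} (w : Fin k → Vd d) : Set (Vd d) :=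
  {x | ∃ t : Fin k → ℝ, (∀ j, 0 ≤ t j) ∧ x = ∑ j, t j • w j}

lemma pairE_add_left {d : ℕ} (a b x : Vd d) : pairE (a + b) x = pairE a x + pairE b x :=
  inner_add_left a b x
lemma pairE_add_right {d : ℕ} (a b x : Vd d) : pairE x (a + b) = pairE x a + pairE x b :=
  inner_add_right x a b
lemma pairE_sub_right {d : ℕ} (a b x : Vd d) : pairE x (a - b) = pairE x a - pairE x b :=
  inner_sub_right x a b
lemma pairE_smul_left {d : ℕ} (r : ℝ) (a x : Vd d) : pairE (r • a) x = r * pairE a x :=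
  real_inner_smul_left a x r
lemma pairE_smul_right {d : ℕ} (r : ℝ) (a x : Vd d) : pairE x (r • a) = r * pairE x a :=
  real_inner_smul_right x a r
lemma pairE_neg_left {d : ℕ} (a x : Vd d) : pairE (-a) x = - pairE a x :=
  inner_neg_left a x
lemma pairE_zero_right {d : ℕ} (x : Vd d) : pairE x 0 = 0 := inner_zero_right x
lemma pairE_zero_left {d : ℕ} (x : Vd d) : pairE 0 x = 0 := inner_zero_left x
lemma pairE_sum_right {d : ℕ} {ι : Type*} (s : Finset ι) (f : ι → Vd d) (x : Vd d) :
    pairE x (∑ i ∈ s, f i) = ∑ i ∈ s, pairE x (f i) := inner_sum s f x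

lemma IsDualIntegral.comb {d : ℕ} {Λ : AddSubgroup (Vd d)} {φ ψ : Vd d}
    (h1 : IsDualIntegral Λ φ) (h2 : IsDualIntegral Λ ψ) (m n : ℤ) :
    IsDualIntegral Λ ((m : ℝ) • φ + (n : ℝ) • ψ) := by
  intro x hx
  obtain ⟨a, ha⟩ := h1 x hx
  obtain ⟨b, hb⟩ := h2 x hx
  refine ⟨m * a + n * b, ?_⟩
  rw [pairE_add_left, pairE_smul_left, pairE_smul_left, ha, hb]
  push_cast; ring

/-- Data of a basis of a full lattice. -/
lemma exists_lattice_basis {d : ℕ} {Λ : AddSubgroup (Vd d)} (hΛ : IsFullLattice Λ) :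
    ∃ (n : ℕ) (b : Module.Basis (Fin n) ℝ (Vd d)), Λ = AddSubgroup.closure (Set.range b) := by
  obtain ⟨⟨n, b, hb, hΛb⟩, hsp⟩ := hΛ
  have hs : Submodule.span ℝ (Set.range b) = ⊤ := by
    rw [eq_top_iff, ← hsp, Submodule.span_le]
    intro x hx
    have : Λ ≤ (Submodule.span ℝ (Set.range b)).toAddSubgroup := by
      rw [hΛb, AddSubgroup.closure_le]
      exact Submodule.subset_span
    exact this hx
  refine ⟨n, Module.Basis.mk hb hs.ge, ?_⟩
  rw [Module.Basis.coe_mk]; exact hΛb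

/-- The dual basis. -/
lemma exists_dual_basis {d : ℕ} {Λ : AddSubgroup (Vd d)} (hΛ : IsFullLattice Λ) :
    ∃ (n : ℕ) (φ : Fin n → Vd d), (∀ i, IsDualIntegral Λ (φ i)) ∧
      ∀ x, (∀ i, pairE (φ i) x = 0) → x = 0 := by
  obtain ⟨n, b, hb⟩ := exists_lattice_basis hΛ
  let φ : Fin n → Vd d := fun i =>
    (InnerProductSpace.toDual ℝ (Vd d)).symm (LinearMap.toContinuousLinearMap (b.coord i))
  have hφ : ∀ i x, pairE (φ i) x = b.coord i x := by
    intro i x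
    simp only [pairE, φ]
    rw [InnerProductSpace.toDual_symm_apply]; rfl
  refine ⟨n, φ, ?_, ?_⟩
  · intro i x hx
    rw [hφ]
    rw [hb] at hx
    induction hx using AddSubgroup.closure_induction with
    | mem x hx =>
      obtain ⟨j, rfl⟩ := hx
      by_cases h : j = i
      · exact ⟨1, by simp [h]⟩
      · exact ⟨0, by simp [h]⟩
    | zero => exact ⟨0, by simp⟩
    | add x y _ _ h1 h2 =>
      obtain ⟨a, ha⟩ := h1
      obtain ⟨c, hc⟩ := h2
      exact ⟨a + c, by rw [map_add, ha, hc]; push_cast; rfl⟩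
    | neg x _ h1 =>
      obtain ⟨a, ha⟩ := h1
      exact ⟨-a, by rw [map_neg, ha]; push_cast; rfl⟩
  · intro x hx
    apply b.ext_elem
    intro i
    have := hx i
    rw [hφ] at this
    simpa using this

/-- elimination of one variable -/
lemma fm_step {X : Type*} (Φ : Finset X) (f a : X → ℝ) :
    (∃ t : ℝ, 0 ≤ t ∧ ∀ φ ∈ Φ, f φ - t * a φ ≤ 0) ↔
    ((∀ φ ∈ Φ, a φ ≤ 0 → f φ ≤ 0) ∧
      ∀ φ ∈ Φ, ∀ ψ ∈ Φ, 0 < a φ → a ψ < 0 → -a ψ * f φ + a φ * f ψ ≤ 0) := by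
  constructor
  · rintro ⟨t, ht, h⟩
    refine ⟨?_, ?_⟩
    · intro φ hφ ha
      have := h φ hφ
      nlinarith
    · intro φ hφ ψ hψ h1 h2
      have e1 := h φ hφ
      have e2 := h ψ hψ
      nlinarith
  · rintro ⟨h1, h2⟩
    by_cases hne : ∃ φ ∈ Φ, 0 < a φ
    · have hne' : (Φ.filter (fun φ => 0 < a φ)).Nonempty := by
        obtain ⟨φ, h, h'⟩ := hne
        exact ⟨φ, by simp [h, h']⟩
      obtain ⟨φ0, hφ0, hmax⟩ := Finset.exists_max_image _ (fun φ => f φ / a φ) hne'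
      simp only [Finset.mem_filter] at hφ0 hmax
      refine ⟨max 0 (f φ0 / a φ0), le_max_left _ _, ?_⟩
      intro ψ hψ
      rcases lt_trichotomy (a ψ) 0 with h | h | h
      · rcases le_total 0 (f φ0 / a φ0) with h' | h'
        · rw [max_eq_right h']
          have := h2 φ0 hφ0.1 ψ hψ hφ0.2 h
          have e : f ψ - f φ0 / a φ0 * a ψ = (-a ψ * f φ0 + a φ0 * f ψ) / a φ0 := by
            have := hφ0.2.ne'
            field_simp; ring
          rw [e]
          exact div_nonpos_of_nonpos_of_nonneg this hφ0.2.le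
        · rw [max_eq_left h']
          have := h1 ψ hψ h.le
          linarith
      · have := h1 ψ hψ h.le
        rw [h]; linarith
      · have e := hmax ψ ⟨hψ, h⟩
        have : f ψ / a ψ ≤ max 0 (f φ0 / a φ0) := e.trans (le_max_right _ _)
        rw [div_le_iff₀ h] at this
        linarith
    · push Not at hne
      refine ⟨0, le_rfl, fun φ hφ => ?_⟩
      have := h1 φ hφ (hne φ hφ)
      linarith

lemma coneOf_succ {d k : ℕ} (w : Fin (k + 1) → Vd d) (x : Vd d) :
    x ∈ coneOf w ↔ ∃ t : ℝ, 0 ≤ t ∧ x - t • w 0 ∈ coneOf (fun i : Fin k => w i.succ) := by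
  constructor
  · rintro ⟨t, ht, rfl⟩
    refine ⟨t 0, ht 0, fun i => t i.succ, fun i => ht _, ?_⟩
    rw [Fin.sum_univ_succ]; simp
  · rintro ⟨t, ht, u, hu, h⟩
    refine ⟨Fin.cons t u, fun j => ?_, ?_⟩
    · refine Fin.cases ?_ ?_ j
      · simpa
      · intro i; simpa using hu i
    · rw [Fin.sum_univ_succ]; simp only [Fin.cons_zero, Fin.cons_succ]
      rw [← h]; simp

lemma coneOf_halfspaces {d : ℕ} {Λ : AddSubgroup (Vd d)} (hΛ : IsFullLattice Λ) :
    ∀ (k : ℕ) (w : Fin k → Vd d), (∀ i, w i ∈ Λ) →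
    ∃ Φ : Finset (Vd d), (∀ φ ∈ Φ, IsDualIntegral Λ φ) ∧
      ∀ x, x ∈ coneOf w ↔ ∀ φ ∈ Φ, pairE φ x ≤ 0 := by
  classical
  intro k
  induction k with
  | zero =>
    intro w _
    obtain ⟨n, φ, hφ, hφ0⟩ := exists_dual_basis hΛ
    refine ⟨Finset.univ.image φ ∪ Finset.univ.image (fun i => - φ i), ?_, ?_⟩
    · intro ψ hψ
      simp only [Finset.mem_union, Finset.mem_image, Finset.mem_univ, true_and] at hψ
      rcases hψ with ⟨i, rfl⟩ | ⟨i, rfl⟩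
      · exact hφ i
      · have := (hφ i).comb (hφ i) (-1) 0
        simpa using this
    · intro x
      constructor
      · rintro ⟨t, -, rfl⟩
        simp [pairE_zero_right]
      · intro h
        have : x = 0 := by
          apply hφ0
          intro i
          apply le_antisymm
          · exact h _ (by simp)
          · have := h (- φ i) (by simp)
            rw [pairE_neg_left] at this
            linarith
        exact ⟨fun _ => 0, by simp, by simp [this]⟩
  | succ k ih =>
    intro w hw
    obtain ⟨Φ, hΦ, hΦ'⟩ := ih (fun i => w i.succ) (fun i => hw _)
    refine ⟨Φ.filter (fun φ => pairE φ (w 0) ≤ 0) ∪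
      ((Φ ×ˢ Φ).filter (fun p => 0 < pairE p.1 (w 0) ∧ pairE p.2 (w 0) < 0)).image
        (fun p => (-pairE p.2 (w 0)) • p.1 + (pairE p.1 (w 0)) • p.2), ?_, ?_⟩
    · intro ψ hψ
      simp only [Finset.mem_union, Finset.mem_filter, Finset.mem_image, Finset.mem_product] at hψ
      rcases hψ with ⟨h, -⟩ | ⟨p, ⟨⟨h1, h2⟩, -⟩, rfl⟩
      · exact hΦ _ h
      · obtain ⟨m, hm⟩ := hΦ _ h1 _ (hw 0)
        obtain ⟨n, hn⟩ := hΦ _ h2 _ (hw 0)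
        rw [hm, hn]
        have := (hΦ _ h1).comb (hΦ _ h2) (-n) m
        simpa using this
    · intro x
      rw [coneOf_succ]
      have := fm_step Φ (fun φ => pairE φ x) (fun φ => pairE φ (w 0))
      simp only [hΦ', pairE_sub_right, pairE_smul_right]
      rw [this]
      constructor
      · rintro ⟨h1, h2⟩ ψ hψ
        simp only [Finset.mem_union, Finset.mem_filter, Finset.mem_image, Finset.mem_product] at hψ
        rcases hψ with ⟨h, h'⟩ | ⟨p, ⟨⟨h3, h4⟩, h5, h6⟩, rfl⟩
        · exact h1 _ h h'
        · rw [pairE_add_left, pairE_smul_left, pairE_smul_left]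
          exact h2 _ h3 _ h4 h5 h6
      · intro h
        refine ⟨fun φ hφ ha => h φ (by simp [hφ, ha]), fun φ hφ ψ hψ ha hb => ?_⟩
        have := h ((-pairE ψ (w 0)) • φ + (pairE φ (w 0)) • ψ) (by
          simp only [Finset.mem_union, Finset.mem_image]
          right
          exact ⟨(φ, ψ), by simp [hφ, hψ, ha, hb], rfl⟩)
        rw [pairE_add_left, pairE_smul_left, pairE_smul_left] at this
        exact this

lemma translate_ratPolyhedron {d : ℕ} {Λ : AddSubgroup (Vd d)} (hΛ : IsFullLattice Λ)
    {s : Vd d} (hs : IsRatPoint Λ s) {k : ℕ} {w : Fin k → Vd d} (hw : ∀ i, w i ∈ Λ) :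
    IsRatPolyhedron Λ ((fun x => s + x) '' coneOf w) := by
  obtain ⟨Φ, hΦ, hΦ'⟩ := coneOf_halfspaces hΛ k w hw
  obtain ⟨q, hq, hqs⟩ := hs
  have hr : ∀ φ ∈ Φ, ∃ r : ℚ, pairE φ s = r := by
    intro φ hφ
    obtain ⟨n, hn⟩ := hΦ φ hφ _ hqs
    refine ⟨n / q, ?_⟩
    rw [pairE_smul_right] at hn
    have : (q : ℝ) ≠ 0 := by exact_mod_cast hq
    push_cast
    field_simp
    linarith
  let e := Φ.equivFin.symm
  choose r hr' using hr
  refine ⟨Φ.card, fun i => (e i : Vd d), fun i => r (e i) (e i).2, fun i => hΦ _ (e i).2, ?_⟩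
  ext x
  rw [hΛ.2]
  simp only [Submodule.mem_top, true_and, Set.mem_setOf_eq]
  have : x ∈ (fun x => s + x) '' coneOf w ↔ x - s ∈ coneOf w := by
    constructor
    · rintro ⟨y, hy, rfl⟩; simpa using hy
    · intro h; exact ⟨x - s, h, by simp⟩
  rw [this, hΦ']
  constructor
  · intro h i
    have := h _ (e i).2
    rw [pairE_sub_right, hr' _ (e i).2] at this
    linarith
  · intro h φ hφ
    have := h (e.symm ⟨φ, hφ⟩)
    simp only [Equiv.apply_symm_apply] at this
    rw [pairE_sub_right, hr' φ hφ]
    linarith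

lemma coneOf_isClosed {d : ℕ} {Λ : AddSubgroup (Vd d)} (hΛ : IsFullLattice Λ)
    {k : ℕ} {w : Fin k → Vd d} (hw : ∀ i, w i ∈ Λ) : IsClosed (coneOf w) := by
  obtain ⟨Φ, hΦ, hΦ'⟩ := coneOf_halfspaces hΛ k w hw
  have : coneOf w = ⋂ φ ∈ Φ, {x | pairE φ x ≤ 0} := by
    ext x; simp [hΦ']
  rw [this]
  refine isClosed_biInter fun φ _ => isClosed_le ?_ continuous_const
  exact continuous_const.inner continuous_id

end

open MeasureTheory Filter Topology Set
open scoped RealInnerProductSpace Pointwise BigOperators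
noncomputable section

lemma upper_stab {k : ℕ} (U : Set (Fin k → ℕ)) (hU : IsUpperSet U) :
    ∃ N : ℕ, ∀ n : Fin k → ℕ, n ∈ U ↔ (fun i => min (n i) N) ∈ U := by
  have hpwo : U.IsPWO := Set.isPWO_of_wellQuasiOrderedLE U
  have hfin : {x | Minimal (· ∈ U) x}.Finite := by
    apply IsAntichain.finite_of_partiallyWellOrderedOn (r := (· ≤ ·))
    · exact setOfPred_minimal_antichain _
    · exact Set.isPWO_of_wellQuasiOrderedLE _
  obtain ⟨N, hN⟩ : ∃ N : ℕ, ∀ g ∈ {x | Minimal (· ∈ U) x}, ∀ i, g i ≤ N := by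
    obtain ⟨B, hB⟩ := hfin.bddAbove
    refine ⟨Finset.univ.sup B, fun g hg i => (hB hg i).trans (Finset.le_sup (Finset.mem_univ i))⟩
  refine ⟨N, fun n => ⟨fun h => ?_, fun h => hU (fun i => min_le_left _ _) h⟩⟩
  obtain ⟨g, hgn, hg⟩ := hpwo.exists_le_minimal h
  exact hU (fun i => le_min (hgn i) (hN g hg i)) hg.1

lemma hs_congr {ι : Type*} {f g : ι → ℝ} {a b : ℝ} (h : HasSum f a) (hf : ∀ i, g i = f i)
    (ha : b = a) : HasSum g b := by
  have : g = f := funext hf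
  rw [this, ha]; exact h

lemma aux_mul {α β : Type*} (f : α → ℝ) (g : β → ℝ) (a b : ℝ) (hf : HasSum f a) (hg : HasSum g b)
    (h1 : ∀ n, 0 ≤ f n) (h2 : ∀ n, 0 ≤ g n) :
    HasSum (fun p : α × β => f p.1 * g p.2) (a * b) :=
  hf.mul hg (hf.summable.mul_of_nonneg hg.summable h1 h2)

lemma hasSum_prod_fin : ∀ (k : ℕ) (f : Fin k → ℕ → ℝ) (a : Fin k → ℝ),
    (∀ i n, 0 ≤ f i n) → (∀ i, HasSum (f i) (a i)) →
    HasSum (fun n : Fin k → ℕ => ∏ i, f i (n i)) (∏ i, a i) := by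
  intro k
  induction k with
  | zero => intro f a _ _; simp
  | succ k ih =>
    intro f a h0 h
    have ih' : HasSum (fun n : Fin k → ℕ => ∏ i : Fin k, f i.succ (n i)) (∏ i : Fin k, a i.succ) :=
      ih (fun i => f i.succ) (fun i => a i.succ) (fun i => h0 _) (fun i => h _)
    have hm := aux_mul (f 0) _ (a 0) _ (h 0) ih' (h0 0)
      (fun n => Finset.prod_nonneg fun i _ => h0 i.succ (n i))
    rw [Fin.prod_univ_succ]
    rw [← (Fin.consEquiv (fun _ : Fin (k + 1) => ℕ)).hasSum_iff]
    refine hs_congr hm (fun p => ?_) rfl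
    simp [Fin.consEquiv, Fin.prod_univ_succ]

/-- numerator polynomial -/
def numP {k : ℕ} (N : ℕ) (D : Set (Fin k → ℕ)) (y : Fin k → ℝ) : ℝ :=
  open Classical in
  ∑ m : Fin k → Fin (N + 1), if (fun i => (m i : ℕ)) ∈ D then
    ∏ i, (if (m i : ℕ) < N then (y i) ^ (m i : ℕ) * (1 - y i) else (y i) ^ N) else 0

lemma hasSum_cell (N : ℕ) (m : Fin (N + 1)) (y : ℝ) (h0 : 0 < y) (h1 : y < 1) :
    HasSum (fun n : ℕ => if min n N = (m : ℕ) then y ^ n else 0)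
      ((1 - y)⁻¹ * (if (m : ℕ) < N then y ^ (m : ℕ) * (1 - y) else y ^ N)) := by
  have h1' : 1 - y ≠ 0 := by linarith
  split_ifs with h
  · have : (1 - y)⁻¹ * (y ^ (m : ℕ) * (1 - y)) = y ^ (m : ℕ) := by field_simp
    rw [this]
    refine hs_congr (hasSum_ite_eq (m : ℕ) (y ^ (m : ℕ))) (fun n => ?_) rfl
    by_cases hn : n = (m : ℕ)
    · subst hn
      have : min (m : ℕ) N = m := min_eq_left h.le
      simp [this]
    · have : min n N ≠ (m : ℕ) := by omega
      simp [hn, this]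
  · have hm : (m : ℕ) = N := by have := m.2; omega
    have hg := (hasSum_geometric_of_lt_one h0.le h1).mul_right (y ^ N)
    have : HasSum (fun n : ℕ => if min (n + N) N = (m : ℕ) then y ^ (n + N) else 0)
        ((1 - y)⁻¹ * y ^ N) := by
      refine hs_congr hg (fun n => ?_) rfl
      have : min (n + N) N = (m : ℕ) := by omega
      rw [if_pos this, pow_add]
    rw [hasSum_nat_add_iff (f := fun n : ℕ => if min n N = (m : ℕ) then y ^ n else 0) N] at this
    refine hs_congr this (fun n => rfl) ?_
    rw [Finset.sum_eq_zero, add_zero]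
    intro i hi
    rw [Finset.mem_range] at hi
    rw [if_neg]; omega

lemma hasSum_D {k : ℕ} (N : ℕ) (D : Set (Fin k → ℕ))
    (hD : ∀ n : Fin k → ℕ, n ∈ D ↔ (fun i => min (n i) N) ∈ D) (y : Fin k → ℝ)
    (h0 : ∀ i, 0 < y i) (h1 : ∀ i, y i < 1) :
    HasSum (D.indicator (fun n => ∏ i, y i ^ n i)) ((∏ i, (1 - y i))⁻¹ * numP N D y) := by
  classical
  have hc : ∀ m : Fin k → Fin (N + 1), HasSum
      (fun n : Fin k → ℕ => ∏ i, (if min (n i) N = (m i : ℕ) then y i ^ (n i) else 0))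
      (∏ i, ((1 - y i)⁻¹ * (if (m i : ℕ) < N then y i ^ (m i : ℕ) * (1 - y i) else y i ^ N))) := by
    intro m
    apply hasSum_prod_fin k (fun i n => if min n N = (m i : ℕ) then y i ^ n else 0)
    · intro i n
      have := (h0 i).le
      split_ifs <;> positivity
    · intro i
      exact hasSum_cell N (m i) (y i) (h0 i) (h1 i)
  have hs := hasSum_sum (s := Finset.univ.filter
    (fun m : Fin k → Fin (N + 1) => (fun i => (m i : ℕ)) ∈ D)) (fun m _ => hc m)
  refine hs_congr hs (fun n => ?_) ?_
  · let m0 : Fin k → Fin (N + 1) := fun i => ⟨min (n i) N, by omega⟩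
    have key : ∀ m : Fin k → Fin (N + 1), m ≠ m0 →
        ∏ i, (if min (n i) N = (m i : ℕ) then y i ^ (n i) else 0) = 0 := by
      intro m hm
      obtain ⟨i, hi⟩ := Function.ne_iff.1 hm
      apply Finset.prod_eq_zero (Finset.mem_univ i)
      rw [if_neg]
      intro h
      exact hi (Fin.ext h.symm)
    have key2 : ∏ i, (if min (n i) N = (m0 i : ℕ) then y i ^ (n i) else 0) = ∏ i, y i ^ n i := by
      apply Finset.prod_congr rfl
      intro i _
      simp [m0]
    by_cases hn : n ∈ D
    · rw [Set.indicator_of_mem hn, Finset.sum_eq_single m0, key2]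
      · intro m _ hm; exact key m hm
      · intro h
        exact absurd (Finset.mem_filter.2 ⟨Finset.mem_univ m0, (hD n).1 hn⟩) h
    · rw [Set.indicator_of_notMem hn, Finset.sum_eq_zero]
      intro m hm
      apply key
      rintro rfl
      exact hn ((hD n).2 (Finset.mem_filter.1 hm).2)
  · rw [numP, Finset.sum_filter, Finset.mul_sum]
    apply Finset.sum_congr rfl
    intro m _
    split_ifs
    · rw [Finset.prod_mul_distrib, Finset.prod_inv_distrib]
    · simp

/-- sets whose generating function has the expected denominator -/
def GoodSet {d k : ℕ} (w : Fin k → Vd d) (A : Set (Vd d)) : Prop :=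
  ∃ G : Vd d → ℝ, (∀ ξ, AnalyticAt ℝ G ξ) ∧ ∀ ξ, (∀ i, pairE ξ (w i) < 0) →
    HasSum (A.indicator (fun x => Real.exp (pairE ξ x)))
      ((∏ i, (1 - Real.exp (pairE ξ (w i))))⁻¹ * G ξ)

lemma analyticAt_pairE {d : ℕ} (x ξ : Vd d) : AnalyticAt ℝ (fun ξ : Vd d => pairE ξ x) ξ := by
  have : (fun ξ : Vd d => pairE ξ x) = fun ξ => innerSL ℝ x ξ := by
    funext ξ; simp [pairE, real_inner_comm]
  rw [this]
  exact (innerSL ℝ x).analyticAt ξ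

lemma analyticAt_expE {d : ℕ} (x ξ : Vd d) :
    AnalyticAt ℝ (fun ξ : Vd d => Real.exp (pairE ξ x)) ξ :=
  (analyticAt_pairE x ξ).rexp

lemma analyticAt_numP {d k : ℕ} (w : Fin k → Vd d) (N : ℕ) (D : Set (Fin k → ℕ)) (ξ : Vd d) :
    AnalyticAt ℝ (fun ξ => numP N D (fun i => Real.exp (pairE ξ (w i)))) ξ := by
  classical
  unfold numP
  apply Finset.analyticAt_fun_sum
  intro m _
  split_ifs
  · apply Finset.analyticAt_fun_prod
    intro i _
    split_ifs
    · exact ((analyticAt_expE _ _).pow _).mul (analyticAt_const.sub (analyticAt_expE _ _))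
    · exact (analyticAt_expE _ _).pow _
  · exact analyticAt_const

lemma good_image {d k : ℕ} (w : Fin k → Vd d) (f : Vd d) (U : Set (Fin k → ℕ)) (hU : IsUpperSet U)
    (hinj : Set.InjOn (fun n : Fin k → ℕ => f + ∑ i, (n i : ℝ) • w i) Uᶜ) :
    GoodSet w ((fun n : Fin k → ℕ => f + ∑ i, (n i : ℝ) • w i) '' Uᶜ) := by
  obtain ⟨N, hN⟩ := upper_stab U hU
  refine ⟨fun ξ => Real.exp (pairE ξ f) * numP N Uᶜ (fun i => Real.exp (pairE ξ (w i))),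
    fun ξ => (analyticAt_expE f ξ).mul (analyticAt_numP w N _ ξ), ?_⟩
  intro ξ hξ
  have h := hasSum_D N Uᶜ (fun n => not_congr (hN n)) (fun i => Real.exp (pairE ξ (w i)))
    (fun i => Real.exp_pos _) (fun i => by simpa using hξ i)
  have h2 := h.mul_left (Real.exp (pairE ξ f))
  rw [← hasSum_subtype_iff_indicator, ← (Equiv.Set.imageOfInjOn _ _ hinj).hasSum_iff]
  have h3 : HasSum (Uᶜ.indicator
      (fun n => Real.exp (pairE ξ f) * ∏ i, (Real.exp (pairE ξ (w i))) ^ n i))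
      ((∏ i, (1 - Real.exp (pairE ξ (w i))))⁻¹ * (Real.exp (pairE ξ f) *
        numP N Uᶜ (fun i => Real.exp (pairE ξ (w i))))) := by
    refine hs_congr h2 (fun n => ?_) ?_
    · by_cases hn : n ∈ Uᶜ
      · rw [Set.indicator_of_mem hn, Set.indicator_of_mem hn]
      · rw [Set.indicator_of_notMem hn, Set.indicator_of_notMem hn, mul_zero]
    · ring
  rw [← hasSum_subtype_iff_indicator] at h3
  refine hs_congr h3 (fun n => ?_) rfl
  show Real.exp (pairE ξ (f + ∑ i, ((n : Fin k → ℕ) i : ℝ) • w i)) =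
    Real.exp (pairE ξ f) * ∏ i, (Real.exp (pairE ξ (w i))) ^ (n : Fin k → ℕ) i
  rw [pairE_add_right, pairE_sum_right, Real.exp_add, Real.exp_sum]
  congr 1
  apply Finset.prod_congr rfl
  intro i _
  rw [pairE_smul_right, Real.exp_nat_mul]

lemma good_union {d k : ℕ} {w : Fin k → Vd d} {A B : Set (Vd d)} (hA : GoodSet w A)
    (hB : GoodSet w B) (h : Disjoint A B) : GoodSet w (A ∪ B) := by
  obtain ⟨G, hG, hG'⟩ := hA
  obtain ⟨H, hH, hH'⟩ := hB
  refine ⟨fun ξ => G ξ + H ξ, fun ξ => (hG ξ).add (hH ξ), fun ξ hξ => ?_⟩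
  have := (hG' ξ hξ).add (hH' ξ hξ)
  rw [mul_add]
  refine hs_congr this (fun x => ?_) rfl
  rw [Set.indicator_union_of_disjoint h]

lemma good_fg {d k : ℕ} (w : Fin k → Vd d) (F : Finset (Vd d)) :
    GoodSet w {x | ∃ f ∈ F, ∃ n : Fin k → ℕ, x = f + ∑ i, (n i : ℝ) • w i} := by
  classical
  induction F using Finset.induction_on with
  | empty => exact ⟨fun _ => 0, fun _ => analyticAt_const, fun ξ _ => by simp⟩
  | insert f F hf ih =>
    set A := {x | ∃ f ∈ F, ∃ n : Fin k → ℕ, x = f + ∑ i, (n i : ℝ) • w i} with hA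
    let L : (Fin k → ℕ) → Vd d := fun n => f + ∑ i, (n i : ℝ) • w i
    have Ladd : ∀ n m, L (n + m) = L n + ∑ i, (m i : ℝ) • w i := by
      intro n m
      simp only [L, Pi.add_apply, Nat.cast_add, add_smul, Finset.sum_add_distrib]
      abel
    let U : Set (Fin k → ℕ) := {n | L n ∈ A ∨ ∃ n', toLex n' < toLex n ∧ L n' = L n}
    have hU : IsUpperSet U := by
      intro n n1 hle hn
      obtain ⟨m, rfl⟩ : ∃ m, n1 = n + m := ⟨n1 - n, by
        funext i; have : n i ≤ n1 i := hle i; simp; omega⟩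
      rcases hn with hn | ⟨n', hlt, he⟩
      · left
        obtain ⟨g, hg, p, hp⟩ := hn
        refine ⟨g, hg, p + m, ?_⟩
        rw [Ladd, hp]
        simp only [Pi.add_apply, Nat.cast_add, add_smul, Finset.sum_add_distrib]
        abel
      · right
        refine ⟨n' + m, ?_, ?_⟩
        · rw [toLex_add, toLex_add]
          exact add_lt_add_left hlt _
        · rw [Ladd, Ladd, he]
    have hinj : Set.InjOn L Uᶜ := by
      intro n hn n' hn' he
      rcases lt_trichotomy (toLex n) (toLex n') with h | h | h
      · exact absurd (Or.inr ⟨n, h, he⟩) hn'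
      · exact toLex_inj.1 h
      · exact absurd (Or.inr ⟨n', h, he.symm⟩) hn
    have hg := good_image w f U hU hinj
    have hdis : Disjoint A (L '' Uᶜ) := by
      rw [Set.disjoint_right]
      rintro x ⟨n, hn, rfl⟩ hx
      exact hn (Or.inl hx)
    have := good_union ih hg hdis
    convert this using 1
    ext x
    constructor
    · rintro ⟨g, hg, n, rfl⟩
      rcases Finset.mem_insert.1 hg with rfl | hg
      · by_cases hx : L n ∈ A
        · exact Or.inl hx
        · right
          have hne : {m : Lex (Fin k → ℕ) | L (ofLex m) = L n}.Nonempty := ⟨toLex n, rfl⟩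
          obtain ⟨m, hm, hmin⟩ := WellFounded.has_min
            (wellFounded_lt : WellFounded ((· < ·) : Lex (Fin k → ℕ) → _ → Prop)) _ hne
          refine ⟨ofLex m, ?_, hm⟩
          rintro (h | ⟨n', hlt, he⟩)
          · exact hx (by rw [← show L (ofLex m) = L n from hm]; exact h)
          · exact hmin (toLex n') (he.trans hm) hlt
      · exact Or.inl ⟨g, hg, n, rfl⟩
    · rintro (⟨g, hg, n, rfl⟩ | ⟨n, -, rfl⟩)
      · exact ⟨g, Finset.mem_insert_of_mem hg, n, rfl⟩
      · exact ⟨f, Finset.mem_insert_self _ _, n, rfl⟩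

/-- lattice points of a rational affine cone form a good set. -/
lemma good_cone {d : ℕ} {Λ : AddSubgroup (Vd d)} (hΛ : IsFullLattice Λ) (s : Vd d)
    {k : ℕ} {w : Fin k → Vd d} (hw : ∀ i, w i ∈ Λ) :
    GoodSet w (((fun x => s + x) '' coneOf w) ∩ (Λ : Set (Vd d))) := by
  obtain ⟨n, b, hb⟩ := exists_lattice_basis hΛ
  have hbdd : Bornology.IsBounded {x : Vd d | ‖x‖ ≤ ‖s‖ + ∑ i, ‖w i‖} := by
    have : {x : Vd d | ‖x‖ ≤ ‖s‖ + ∑ i, ‖w i‖} = Metric.closedBall 0 (‖s‖ + ∑ i, ‖w i‖) := by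
      ext; simp
    rw [this]; exact Metric.isBounded_closedBall
  have hfin : ({x : Vd d | ‖x‖ ≤ ‖s‖ + ∑ i, ‖w i‖} ∩ (Λ : Set (Vd d))).Finite := by
    have := ZSpan.setFinite_inter b hbdd
    refine this.subset ?_
    rintro x ⟨h1, h2⟩
    refine ⟨h1, ?_⟩
    rw [SetLike.mem_coe, hb] at h2
    have hle : AddSubgroup.closure (Set.range b) ≤
        (Submodule.span ℤ (Set.range b)).toAddSubgroup := by
      rw [AddSubgroup.closure_le]; exact Submodule.subset_span
    exact hle h2
  have hfin2 : ((((fun x => s + x) '' coneOf w) ∩ (Λ : Set (Vd d))) ∩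
      {x : Vd d | ‖x‖ ≤ ‖s‖ + ∑ i, ‖w i‖}).Finite :=
    hfin.subset (fun x hx => ⟨hx.2, hx.1.2⟩)
  have hsum : ∀ n : Fin k → ℕ, ∑ i, (n i : ℝ) • w i ∈ Λ := by
    intro n
    apply AddSubgroup.sum_mem
    intro i _
    rw [Nat.cast_smul_eq_nsmul]
    exact AddSubgroup.nsmul_mem _ (hw i) _
  convert good_fg w hfin2.toFinset using 1
  ext x
  constructor
  · rintro ⟨⟨y, ⟨t, ht, rfl⟩, rfl⟩, hx⟩
    have he : s + ∑ j, t j • w j =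
        (s + ∑ j, Int.fract (t j) • w j) + ∑ j, ((⌊t j⌋₊ : ℕ) : ℝ) • w j := by
      rw [add_assoc, ← Finset.sum_add_distrib]
      congr 1
      apply Finset.sum_congr rfl
      intro j _
      rw [← add_smul]
      congr 1
      have : ((⌊t j⌋₊ : ℕ) : ℝ) = (⌊t j⌋ : ℝ) := by
        exact natCast_floor_eq_intCast_floor (ht j)
      rw [this, Int.fract_add_floor]
    refine ⟨s + ∑ j, Int.fract (t j) • w j, ?_, fun j => ⌊t j⌋₊, he⟩
    rw [Set.Finite.mem_toFinset]
    refine ⟨⟨⟨_, ⟨fun j => Int.fract (t j), fun j => Int.fract_nonneg _, rfl⟩, rfl⟩, ?_⟩, ?_⟩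
    · have : s + ∑ j, Int.fract (t j) • w j = (s + ∑ j, t j • w j)
          - ∑ j, ((⌊t j⌋₊ : ℕ) : ℝ) • w j := by rw [he]; abel
      rw [this]
      exact AddSubgroup.sub_mem _ hx (hsum _)
    · show ‖_‖ ≤ _
      refine (norm_add_le _ _).trans ?_
      gcongr
      refine (norm_sum_le _ _).trans ?_
      apply Finset.sum_le_sum
      intro i _
      rw [norm_smul, Real.norm_eq_abs, abs_of_nonneg (Int.fract_nonneg _)]
      have := (Int.fract_lt_one (t i)).le
      nlinarith [norm_nonneg (w i)]
  · rintro ⟨f, hf, n, rfl⟩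
    rw [Set.Finite.mem_toFinset] at hf
    obtain ⟨⟨⟨y, ⟨t, ht, rfl⟩, rfl⟩, hx⟩, -⟩ := hf
    refine ⟨⟨∑ j, (t j + n j) • w j, ⟨fun j => t j + n j, fun j => by have := ht j; positivity, rfl⟩, ?_⟩, ?_⟩
    · simp only [add_smul, Finset.sum_add_distrib]; abel
    · exact AddSubgroup.add_mem _ hx (hsum _)

end

open MeasureTheory Filter Topology Set
open scoped RealInnerProductSpace Pointwise BigOperators
noncomputable section

/-- the open cone of convergence -/
def negCone {d k : ℕ} (w : Fin k → Vd d) : Set (Vd d) := {ξ | ∀ i, pairE ξ (w i) < 0}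

lemma analyticAt_dslope_exp : AnalyticAt ℝ (dslope Real.exp 0) 0 := by
  obtain ⟨p, hp⟩ := (analyticAt_rexp : AnalyticAt ℝ Real.exp 0)
  exact ⟨_, hp.has_fpower_series_dslope_fslope⟩

lemma dslope_exp_zero : dslope Real.exp 0 0 = 1 := by simp [dslope_same]

lemma mul_inv_one_sub_exp (x : ℝ) (hx : x < 0) :
    x * (1 - Real.exp x)⁻¹ = - (dslope Real.exp 0 x)⁻¹ := by
  rw [dslope_of_ne _ hx.ne, slope_def_field]
  have : Real.exp x < 1 := by simpa using hx
  have h1 : 1 - Real.exp x ≠ 0 := by linarith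
  have h2 : Real.exp x - 1 ≠ 0 := by linarith
  simp only [Real.exp_zero, sub_zero, inv_div]
  have := hx.ne
  rw [← div_eq_mul_inv, div_eq_iff h1, ← neg_div, div_mul_eq_mul_div, eq_div_iff h2]
  ring

lemma good_analytic {d k : ℕ} {w : Fin k → Vd d} {A : Set (Vd d)} (hA : GoodSet w A) :
    ∃ T : Vd d → ℝ, AnalyticAt ℝ T 0 ∧ ∀ ξ ∈ negCone w,
      Summable (A.indicator (fun x => Real.exp (pairE ξ x))) ∧
      (∏ i, pairE ξ (w i)) * ∑' x, A.indicator (fun x => Real.exp (pairE ξ x)) x = T ξ := by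
  obtain ⟨G, hG, hG'⟩ := hA
  refine ⟨fun ξ => (∏ i, - (dslope Real.exp 0 (pairE ξ (w i)))⁻¹) * G ξ, ?_, ?_⟩
  · refine AnalyticAt.mul ?_ (hG 0)
    apply Finset.analyticAt_fun_prod
    intro i _
    have h0 : pairE (0 : Vd d) (w i) = 0 := pairE_zero_left _
    have h1 : AnalyticAt ℝ (dslope Real.exp 0) (pairE (0 : Vd d) (w i)) := by
      rw [h0]; exact analyticAt_dslope_exp
    have h2 : AnalyticAt ℝ (fun ξ : Vd d => dslope Real.exp 0 (pairE ξ (w i))) 0 :=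
      AnalyticAt.comp (g := dslope Real.exp 0) (f := fun ξ : Vd d => pairE ξ (w i)) h1
        (analyticAt_pairE (w i) 0)
    refine (h2.inv ?_).neg
    rw [h0, dslope_exp_zero]; exact one_ne_zero
  · intro ξ hξ
    have h := hG' ξ hξ
    refine ⟨h.summable, ?_⟩
    rw [h.tsum_eq, ← mul_assoc, ← Finset.prod_inv_distrib, ← Finset.prod_mul_distrib]
    congr 1
    apply Finset.prod_congr rfl
    intro i _
    exact mul_inv_one_sub_exp _ (hξ i)

lemma mero_conclude {d : ℕ} {Λ : AddSubgroup (Vd d)} {f : Vd d → ℝ} (hf : RatMeromorphicAt0 Λ f)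
    {T p : Vd d → ℝ} (hT : AnalyticAt ℝ T 0) (hp : AnalyticAt ℝ p 0) {C : Set (Vd d)}
    (hC : IsOpen C) (h0 : (0 : Vd d) ∈ closure C) (h : ∀ ξ ∈ C, p ξ * f ξ = T ξ) :
    MeroEqAt0 (fun ξ => p ξ * f ξ) T := by
  obtain ⟨g, q, ⟨pg, hg, -⟩, ⟨pq, hq, -⟩, hne, hfe⟩ := hf
  have hg : AnalyticAt ℝ g 0 := ⟨_, hg⟩
  have hq : AnalyticAt ℝ q 0 := ⟨_, hq⟩
  have hev := ((hT.eventually_analyticAt.and hp.eventually_analyticAt).and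
    (hg.eventually_analyticAt.and hq.eventually_analyticAt)).and hfe
  obtain ⟨r, hr, hball⟩ := Metric.eventually_nhds_iff_ball.1 hev
  have hpre : IsPreconnected (Metric.ball (0 : Vd d) r) := (convex_ball 0 r).isPreconnected
  have hqnz : ∀ z ∈ Metric.ball (0 : Vd d) r, ¬ (q =ᶠ[𝓝 z] 0) := by
    intro z hz hqz
    have hEq := AnalyticOnNhd.eqOn_zero_of_preconnected_of_eventuallyEq_zero
      (f := q) (U := Metric.ball (0 : Vd d) r) (fun x hx => (hball x hx).1.2.2) hpre hz hqz
    exact hne (Filter.mem_of_superset (Metric.ball_mem_nhds 0 hr) hEq)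
  -- the key identity
  let K : Vd d → ℝ := fun ξ => q ξ * (q ξ * T ξ - p ξ * g ξ)
  have hK : AnalyticOnNhd ℝ K (Metric.ball 0 r) := fun x hx =>
    (hball x hx).1.2.2.mul (((hball x hx).1.2.2.mul (hball x hx).1.1.1).sub
      ((hball x hx).1.1.2.mul (hball x hx).1.2.1))
  obtain ⟨z, hz1, hz2⟩ := mem_closure_iff.1 h0 _ Metric.isOpen_ball (Metric.mem_ball_self hr)
  have hKz : K =ᶠ[𝓝 z] 0 := by
    filter_upwards [(Metric.isOpen_ball.inter hC).mem_nhds ⟨hz1, hz2⟩] with ξ hξ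
    by_cases hq0 : q ξ = 0
    · simp [K, hq0]
    · have e1 := (hball ξ hξ.1).2 hq0
      have e2 := h ξ hξ.2
      have : q ξ * T ξ - p ξ * g ξ = 0 := by rw [← e1, ← e2]; ring
      simp [K, this]
  have hKall := AnalyticOnNhd.eqOn_zero_of_preconnected_of_eventuallyEq_zero hK hpre hz1 hKz
  refine ⟨{ξ | q ξ = 0} ∩ Metric.closedBall 0 (r / 2), ?_, ?_, ?_⟩
  · have hc : ContinuousOn q (Metric.closedBall 0 (r / 2)) := fun x hx =>
      ((hball x (Metric.closedBall_subset_ball (by linarith) hx)).1.2.2.continuousAt).continuousWithinAt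
    have := hc.preimage_isClosed_of_isClosed Metric.isClosed_closedBall (isClosed_singleton (x := (0 : ℝ)))
    rw [Set.inter_comm]
    exact this
  · rw [Set.eq_empty_iff_forall_notMem]
    intro z hz
    have hz' := interior_subset hz
    refine hqnz z (Metric.closedBall_subset_ball (by linarith) hz'.2) ?_
    filter_upwards [mem_interior_iff_mem_nhds.1 hz] with ξ hξ
    exact hξ.1
  · filter_upwards [Metric.closedBall_mem_nhds (0 : Vd d) (by linarith : 0 < r / 2)] with ξ hξ hnot
    have hq0 : q ξ ≠ 0 := fun h => hnot ⟨h, hξ⟩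
    have hξ' := Metric.closedBall_subset_ball (by linarith : r / 2 < r) hξ
    have e1 := (hball ξ hξ').2 hq0
    have e2 : q ξ * (q ξ * T ξ - p ξ * g ξ) = 0 := hKall hξ'
    have e3 := (mul_eq_zero.1 e2).resolve_left hq0
    rw [← e1] at e3
    have : q ξ * (T ξ - p ξ * f ξ) = 0 := by linarith
    have := (mul_eq_zero.1 this).resolve_left hq0
    linarith

lemma negCone_isOpen {d k : ℕ} (w : Fin k → Vd d) : IsOpen (negCone w) := by
  have : negCone w = ⋂ i, {ξ | pairE ξ (w i) < 0} := by ext; simp [negCone]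
  rw [this]
  refine isOpen_iInter_of_finite fun i => isOpen_lt ?_ continuous_const
  exact continuous_id.inner continuous_const

lemma negCone_nonempty {d k : ℕ} (w : Fin k → Vd d) (hw : ∀ i, w i ≠ 0) (s : Vd d)
    (hp : ¬ ContainsLine ((fun x => s + x) '' coneOf w)) : (negCone w).Nonempty := by
  let L : (Fin k → ℝ) →ₗ[ℝ] Vd d := Fintype.linearCombination ℝ w
  have hL : ∀ t, L t = ∑ i, t i • w i := fun t => Fintype.linearCombination_apply ℝ w t
  have hLc : Continuous L := L.continuous_of_finiteDimensional
  let K := L '' stdSimplex ℝ (Fin k)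
  have hKc : IsClosed K := ((isCompact_stdSimplex ℝ (Fin k)).image hLc).isClosed
  have hKx : Convex ℝ K := (convex_stdSimplex ℝ (Fin k)).linear_image L
  have h0 : (0 : Vd d) ∉ K := by
    rintro ⟨t, ⟨ht0, ht1⟩, ht⟩
    obtain ⟨j, hj⟩ : ∃ j, 0 < t j := by
      by_contra hcon
      push Not at hcon
      have : ∑ i, t i ≤ 0 := Finset.sum_nonpos fun i _ => hcon i
      linarith
    refine hp ⟨s, w j, hw j, fun r => ⟨r • w j, ⟨fun i => |r| / t j * t i + (Pi.single j r : Fin k → ℝ) i, ?_, ?_⟩, rfl⟩⟩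
    · intro i
      by_cases hi : i = j
      · subst hi
        simp only [Pi.single_eq_same]
        rw [div_mul_cancel₀ _ hj.ne']
        linarith [neg_abs_le r]
      · simp only [Pi.single_eq_of_ne hi, add_zero]
        exact mul_nonneg (div_nonneg (abs_nonneg _) hj.le) (ht0 i)
    · simp only [add_smul, Finset.sum_add_distrib, mul_smul]
      rw [← Finset.smul_sum, ← hL, ht, smul_zero, zero_add, Finset.sum_eq_single j]
      · simp
      · intro i _ hi; simp [Pi.single_eq_of_ne hi]
      · simp
  obtain ⟨f, u, hf, hu⟩ := geometric_hahn_banach_closed_point hKx hKc h0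
  refine ⟨(InnerProductSpace.toDual ℝ (Vd d)).symm f, fun i => ?_⟩
  show @inner ℝ _ _ ((InnerProductSpace.toDual ℝ (Vd d)).symm f) (w i) < 0
  rw [InnerProductSpace.toDual_symm_apply]
  have := hf (w i) ⟨Pi.single i 1, single_mem_stdSimplex ℝ i, by
    rw [hL, Finset.sum_eq_single i]
    · simp
    · intro j _ hj; simp [Pi.single_eq_of_ne hj]
    · simp⟩
  rw [map_zero] at hu
  linarith

lemma zero_mem_closure_negCone {d k : ℕ} (w : Fin k → Vd d) (h : (negCone w).Nonempty) :
    (0 : Vd d) ∈ closure (negCone w) := by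
  obtain ⟨ξ, hξ⟩ := h
  have h1 : Tendsto (fun t : ℝ => t • ξ) (𝓝[>] 0) (𝓝 0) := by
    have : Tendsto (fun t : ℝ => t • ξ) (𝓝 0) (𝓝 ((0 : ℝ) • ξ)) :=
      (continuous_id.smul continuous_const).tendsto 0
    rw [zero_smul] at this
    exact this.mono_left nhdsWithin_le_nhds
  refine mem_closure_of_tendsto h1 ?_
  filter_upwards [self_mem_nhdsWithin] with t ht i
  rw [pairE_smul_left]
  exact mul_neg_of_pos_of_neg ht (hξ i)

/-- extraction of a homogeneous component by scaling. -/
lemma homog_limit {d : ℕ} {T : Vd d → ℝ} (hT : AnalyticAt ℝ T 0) (j : ℕ) :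
    ∃ Q : Vd d → ℝ, AnalyticAt ℝ Q 0 ∧ ∀ ξ L,
      Tendsto (fun R : ℝ => R ^ j * T (R⁻¹ • ξ)) atTop (𝓝 L) → L = Q ξ := by
  obtain ⟨p, hp⟩ := hT
  refine ⟨fun ξ => p j (fun _ => ξ), ?_, ?_⟩
  · let D : Vd d →L[ℝ] (Fin j → Vd d) := ContinuousLinearMap.pi (fun _ => ContinuousLinearMap.id ℝ _)
    exact ((p j).analyticAt (x := D 0)).comp (D.analyticAt 0)
  · intro ξ L hL
    have hO := hp.isBigO_sub_partialSum_pow (j + 1)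
    simp only [zero_add] at hO
    have ht : Tendsto (fun R : ℝ => R⁻¹ • ξ) atTop (𝓝 0) := by
      have := (tendsto_inv_atTop_zero (𝕜 := ℝ)).smul_const ξ
      rwa [zero_smul] at this
    have hO2 := hO.comp_tendsto ht
    have hO3 : (fun R : ℝ => R ^ j * (T (R⁻¹ • ξ) - p.partialSum (j + 1) (R⁻¹ • ξ)))
        =O[atTop] (fun R : ℝ => R⁻¹) := by
      have := (Asymptotics.isBigO_refl (fun R : ℝ => R ^ j) atTop).mul hO2
      refine this.trans ?_
      apply Asymptotics.IsBigO.of_bound (‖ξ‖ ^ (j + 1))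
      filter_upwards [eventually_gt_atTop 0] with R hR
      simp only [Function.comp, norm_mul, norm_pow, norm_smul, norm_inv, norm_norm]
      apply le_of_eq
      have : ‖R‖ ≠ 0 := by simpa using hR.ne'
      rw [mul_pow, inv_pow, pow_succ ‖R‖]
      field_simp
    have hz : Tendsto (fun R : ℝ => R ^ j * (T (R⁻¹ • ξ) - p.partialSum (j + 1) (R⁻¹ • ξ)))
        atTop (𝓝 0) := hO3.trans_tendsto tendsto_inv_atTop_zero
    let P : Polynomial ℝ := ∑ i ∈ Finset.range (j + 1),
      Polynomial.C (p i (fun _ => ξ)) * Polynomial.X ^ (j - i)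
    have hP : Tendsto (fun R : ℝ => P.eval R) atTop (𝓝 L) := by
      have := hL.sub hz
      rw [sub_zero] at this
      refine this.congr' ?_
      filter_upwards [eventually_gt_atTop 0] with R hR
      have : R ^ j * T (R⁻¹ • ξ) - R ^ j * (T (R⁻¹ • ξ) - p.partialSum (j + 1) (R⁻¹ • ξ)) =
        R ^ j * p.partialSum (j + 1) (R⁻¹ • ξ) := by ring
      rw [this, FormalMultilinearSeries.partialSum, Finset.mul_sum, Polynomial.eval_finsetSum]
      apply Finset.sum_congr rfl
      intro i hi
      have hi' : i ≤ j := by rw [Finset.mem_range] at hi; omega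
      have e : p i (fun _ => R⁻¹ • ξ) = (R⁻¹) ^ i * p i (fun _ => ξ) := by
        have := (p i).map_smul_univ (fun _ => R⁻¹) (fun _ => ξ)
        simpa using this
      rw [e]
      simp only [Polynomial.eval_mul, Polynomial.eval_C, Polynomial.eval_pow, Polynomial.eval_X]
      rw [pow_sub₀ _ hR.ne' hi', inv_pow]
      ring
    rw [Polynomial.tendsto_nhds_iff] at hP
    obtain ⟨h1, h2⟩ := hP
    have h3 : P.coeff 0 = L := by
      rw [← h1, Polynomial.leadingCoeff, Polynomial.natDegree_eq_zero_iff_degree_le_zero.2 h2]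
    rw [← h3]
    simp only [P, Polynomial.finsetSum_coeff, Polynomial.coeff_C_mul, Polynomial.coeff_X_pow]
    rw [Finset.sum_eq_single j]
    · simp
    · intro i hi hij
      rw [Finset.mem_range] at hi
      have : (0 : ℕ) ≠ j - i := by omega
      simp [this]
    · simp

end

open MeasureTheory Filter Topology Set
open scoped RealInnerProductSpace Pointwise BigOperators
noncomputable section

lemma exists_sublattice_basis {d k : ℕ} {Λ : AddSubgroup (Vd d)} (hΛ : IsFullLattice Λ)
    {w : Fin k → Vd d} (hw : ∀ i, w i ∈ Λ) :
    ∃ (m : ℕ) (b : Fin m → Vd d), m ≤ k ∧ (∀ i, b i ∈ Λ) ∧ LinearIndependent ℝ b ∧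
      Submodule.span ℝ (Set.range b) = Submodule.span ℝ (Set.range w) ∧
      ∀ y ∈ Λ, y ∈ Submodule.span ℝ (Set.range b) →
        ∃ c : Fin m → ℤ, y = ∑ i, (c i : ℝ) • b i := by
  obtain ⟨n, b0, hb0⟩ := exists_lattice_basis hΛ
  let M : Submodule ℤ (Vd d) := Submodule.span ℤ (Set.range b0)
  have hM : ∀ x, x ∈ M ↔ x ∈ Λ := by
    intro x
    rw [hb0]
    show x ∈ Submodule.span ℤ (Set.range b0) ↔ _
    rw [← AddSubgroup.toIntSubmodule_closure]
    rfl
  haveI : DiscreteTopology M := inferInstanceAs (DiscreteTopology (Submodule.span ℤ (Set.range b0)))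
  let W : Submodule ℝ (Vd d) := Submodule.span ℝ (Set.range w)
  let L : Submodule ℤ W := ZLattice.comap ℝ M W.subtype
  haveI : DiscreteTopology L := ZLattice.comap_discreteTopology ℝ M continuous_subtype_val
    W.injective_subtype
  haveI : IsZLattice ℝ L := ⟨by
    have h1 : (L : Set W) ⊇ (Subtype.val ⁻¹' Set.range w : Set W) := by
      rintro x ⟨i, hi⟩
      show (x : Vd d) ∈ M
      rw [hM, ← hi]; exact hw i
    have h2 := Submodule.span_span_coe_preimage (R := ℝ) (s := Set.range w)
    exact top_le_iff.1 (h2.symm.le.trans (Submodule.span_mono h1))⟩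
  let m := Module.finrank ℝ W
  haveI : Module.Finite ℤ L := ZLattice.module_finite ℝ L
  haveI : Module.Free ℤ L := ZLattice.module_free ℝ L
  have hcard : Fintype.card (Module.Free.ChooseBasisIndex ℤ L) = Fintype.card (Fin m) := by
    rw [← Module.finrank_eq_card_chooseBasisIndex, ZLattice.rank ℝ, Fintype.card_fin]
  let B : Module.Basis (Fin m) ℤ L := (Module.Free.chooseBasis ℤ L).reindex
    (Fintype.equivOfCardEq hcard)
  let BR : Module.Basis (Fin m) ℝ W := B.ofZLatticeBasis ℝ L
  have hspan : Submodule.span ℝ (Set.range fun i => ((BR i : W) : Vd d)) = W := by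
    have : (Set.range fun i => ((BR i : W) : Vd d)) = W.subtype '' Set.range BR := by
      rw [← Set.range_comp]; rfl
    rw [this, ← Submodule.map_span, BR.span_eq, Submodule.map_top, Submodule.range_subtype]
  refine ⟨m, fun i => ((BR i : W) : Vd d), ?_, ?_, ?_, hspan, ?_⟩
  · have := finrank_range_le_card (R := ℝ) w
    rwa [Fintype.card_fin] at this
  · intro i
    show ((BR i : W) : Vd d) ∈ Λ
    rw [← hM, Module.Basis.ofZLatticeBasis_apply]
    exact (B i).2
  · exact BR.linearIndependent.map' W.subtype (Submodule.ker_subtype W)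
  · intro y hy hyW
    rw [hspan] at hyW
    let y' : L := ⟨⟨y, hyW⟩, by show y ∈ M; rw [hM]; exact hy⟩
    refine ⟨fun i => B.repr y' i, ?_⟩
    have := BR.sum_repr (y' : W)
    have h2 := congrArg W.subtype this
    rw [map_sum] at h2
    simp only [map_smul] at h2
    rw [show y = W.subtype (y' : W) from rfl, ← h2]
    apply Finset.sum_congr rfl
    intro i _
    rw [Module.Basis.ofZLatticeBasis_repr_apply]
    rfl

lemma affineSpan_translate_cone {d k : ℕ} (s : Vd d) (w : Fin k → Vd d) :
    ((affineSpan ℝ ((fun x => s + x) '' coneOf w) : AffineSubspace ℝ (Vd d)) : Set (Vd d)) =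
      (fun x => s + x) '' (Submodule.span ℝ (Set.range w) : Set (Vd d)) := by
  have hs : s ∈ (fun x => s + x) '' coneOf w :=
    ⟨0, ⟨0, fun _ => le_rfl, by simp⟩, by simp⟩
  have hdir : (affineSpan ℝ ((fun x => s + x) '' coneOf w)).direction =
      Submodule.span ℝ (Set.range w) := by
    rw [direction_affineSpan, vectorSpan_eq_span_vsub_set_right ℝ hs]
    have : (fun x => x -ᵥ s) '' ((fun x => s + x) '' coneOf w) = coneOf w := by
      rw [← Set.image_comp]; simp
    rw [this]
    apply le_antisymm
    · apply Submodule.span_le.2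
      rintro x ⟨t, -, rfl⟩
      exact Submodule.sum_mem _ fun i _ => Submodule.smul_mem _ _ (Submodule.subset_span ⟨i, rfl⟩)
    · apply Submodule.span_mono
      rintro _ ⟨i, rfl⟩
      refine ⟨Pi.single i 1, fun j => ?_, ?_⟩
      · by_cases h : j = i
        · subst h; simp
        · simp [Pi.single_eq_of_ne h]
      · rw [Finset.sum_eq_single i]
        · simp
        · intro j _ hj; simp [Pi.single_eq_of_ne hj]
        · simp
  ext x
  have hs' : s ∈ affineSpan ℝ ((fun x => s + x) '' coneOf w) := subset_affineSpan ℝ _ hs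
  rw [SetLike.mem_coe, ← AffineSubspace.vsub_right_mem_direction_iff_mem hs', hdir]
  constructor
  · intro h; exact ⟨x - s, h, by simp⟩
  · rintro ⟨y, hy, rfl⟩; simpa using hy

end

open MeasureTheory Filter Topology Set
open scoped RealInnerProductSpace Pointwise BigOperators
noncomputable section

/-- coordinatewise floor -/
def floorV {m : ℕ} (t : Fin m → ℝ) : Fin m → ℤ := fun i => ⌊t i⌋

/-- coordinatewise cast -/
def castV {m : ℕ} (z : Fin m → ℤ) : Fin m → ℝ := fun i => (z i : ℝ)

lemma measurable_floorV {m : ℕ} : Measurable (floorV (m := m)) :=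
  measurable_pi_lambda _ fun i => (Int.measurable_floor).comp (measurable_pi_apply i)

lemma map_floorV {m : ℕ} : Measure.map (floorV (m := m)) volume = Measure.count := by
  refine Measure.ext_of_singleton fun z => ?_
  rw [Measure.map_apply measurable_floorV (measurableSet_singleton z), Measure.count_singleton]
  have : floorV ⁻¹' {z} = Set.pi Set.univ fun i => Set.Ico (z i : ℝ) (z i + 1) := by
    ext t
    simp [floorV, funext_iff, Int.floor_eq_iff, Set.mem_pi]
  rw [this, volume_pi_pi]
  simp

lemma abs_floor_approx {R : ℝ} (hR : 0 < R) (x : ℝ) : |R⁻¹ * (⌊R * x⌋ : ℝ) - x| ≤ R⁻¹ := by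
  have h1 := Int.floor_le (R * x)
  have h2 := Int.lt_floor_add_one (R * x)
  have : R⁻¹ * (⌊R * x⌋ : ℝ) - x = R⁻¹ * ((⌊R * x⌋ : ℝ) - R * x) := by field_simp
  rw [this, abs_mul, abs_of_pos (inv_pos.2 hR)]
  have : |(⌊R * x⌋ : ℝ) - R * x| ≤ 1 := by rw [abs_le]; constructor <;> linarith
  nlinarith [inv_pos.2 hR]

lemma integrable_exp_neg_abs {a : ℝ} (ha : 0 < a) : Integrable (fun x : ℝ => Real.exp (-a * |x|)) := by
  have h1 : IntegrableOn (fun x : ℝ => Real.exp (-a * |x|)) (Set.Ioi 0) := by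
    refine (integrableOn_exp_mul_Ioi (neg_neg_of_pos ha) 0).congr_fun (fun x hx => ?_)
      measurableSet_Ioi
    simp only [abs_of_pos (show (0 : ℝ) < x from hx)]
  have h2 : IntegrableOn (fun x : ℝ => Real.exp (-a * |x|)) (Set.Iic 0) := by
    refine (integrableOn_exp_mul_Iic ha 0).congr_fun (fun x hx => ?_) measurableSet_Iic
    simp only [abs_of_nonpos (show x ≤ (0 : ℝ) from hx), neg_mul_neg]
  have := h2.union h1
  rwa [Set.Iic_union_Ioi, integrableOn_univ] at this

lemma integrable_prod_exp {m : ℕ} {a : ℝ} (ha : 0 < a) :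
    Integrable (fun t : Fin m → ℝ => Real.exp (-a * ∑ i, |t i|)) := by
  have := MeasureTheory.Integrable.fintype_prod (ι := Fin m) (E := ℝ)
    (f := fun _ (x : ℝ) => Real.exp (-a * |x|)) (μ := fun _ => volume) (fun _ => integrable_exp_neg_abs ha)
  refine this.congr (Eventually.of_forall fun t => ?_)
  simp only [Finset.mul_sum, Real.exp_sum]

lemma riemann_sum {m : ℕ} {g : (Fin m → ℝ) → ℝ} (hg : Measurable g) {a : ℝ} (ha : 0 < a)
    (hb : ∀ t, |g t| ≤ Real.exp (-a * ∑ i, |t i|)) (hc : ∀ᵐ t, ContinuousAt g t) :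
    Tendsto (fun R : ℝ => (R ^ m)⁻¹ * ∑' z : Fin m → ℤ, g (R⁻¹ • castV z)) atTop
      (𝓝 (∫ t, g t)) := by
  let G : ℝ → (Fin m → ℝ) → ℝ := fun R t => g (R⁻¹ • castV (floorV (R • t)))
  have hcast : Measurable (castV (m := m)) := measurable_of_countable _
  have hGm : ∀ R, Measurable (G R) := fun R =>
    hg.comp ((hcast.comp (measurable_floorV.comp (measurable_const_smul R))).const_smul R⁻¹)
  let bound : (Fin m → ℝ) → ℝ := fun t => Real.exp (a * m) * Real.exp (-a * ∑ i, |t i|)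
  have hbi : Integrable bound := (integrable_prod_exp ha).const_mul _
  have hGb : ∀ R, 1 ≤ R → ∀ t, ‖G R t‖ ≤ bound t := by
    intro R hR t
    have hR0 : 0 < R := by linarith
    refine (hb _).trans ?_
    show _ ≤ Real.exp (a * m) * Real.exp (-a * ∑ i, |t i|)
    rw [← Real.exp_add, Real.exp_le_exp]
    have : ∑ i, |t i| ≤ ∑ i, (|(R⁻¹ • castV (floorV (R • t))) i| + 1) := by
      apply Finset.sum_le_sum
      intro i _
      have h1 := abs_floor_approx hR0 (t i)
      have h2 : R⁻¹ ≤ 1 := inv_le_one_of_one_le₀ hR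
      have h3 : (R⁻¹ • castV (floorV (R • t))) i = R⁻¹ * (⌊R * t i⌋ : ℝ) := rfl
      rw [h3]
      have h4 := abs_sub_abs_le_abs_sub (t i) (R⁻¹ * (⌊R * t i⌋ : ℝ))
      rw [abs_sub_comm] at h4
      linarith
    rw [Finset.sum_add_distrib] at this
    simp only [Finset.sum_const, Finset.card_univ, Fintype.card_fin, nsmul_eq_mul, mul_one] at this
    nlinarith
  have hGi : ∀ R, 1 ≤ R → Integrable (G R) := fun R hR =>
    hbi.mono' (hGm R).aestronglyMeasurable (Eventually.of_forall (hGb R hR))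
  have hlim : Tendsto (fun R : ℝ => ∫ t, G R t) atTop (𝓝 (∫ t, g t)) := by
    refine tendsto_integral_filter_of_dominated_convergence bound
      (Eventually.of_forall fun R => (hGm R).aestronglyMeasurable) ?_ hbi ?_
    · filter_upwards [eventually_ge_atTop 1] with R hR
      exact Eventually.of_forall (hGb R hR)
    · filter_upwards [hc] with t ht
      refine ht.tendsto.comp ?_
      rw [tendsto_pi_nhds]
      intro i
      rw [tendsto_iff_dist_tendsto_zero]
      refine squeeze_zero' (Eventually.of_forall fun _ => dist_nonneg) ?_ tendsto_inv_atTop_zero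
      filter_upwards [eventually_gt_atTop 0] with R hR
      exact abs_floor_approx hR (t i)
  refine hlim.congr' ?_
  filter_upwards [eventually_ge_atTop 1] with R hR
  have hR0 : 0 < R := by linarith
  let h : (Fin m → ℤ) → ℝ := fun z => g (R⁻¹ • castV z)
  have e1 : ∫ t, G R t = (R ^ m)⁻¹ * ∫ u, h (floorV u) := by
    have := Measure.integral_comp_smul (volume : Measure (Fin m → ℝ)) (fun u => h (floorV u)) R
    rw [Module.finrank_fin_fun, abs_of_pos (inv_pos.2 (pow_pos hR0 m)), smul_eq_mul] at this
    exact this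
  have hi1 : Integrable (fun u : Fin m → ℝ => h (floorV u)) :=
    (integrable_comp_smul_iff volume (fun u : Fin m → ℝ => h (floorV u)) hR0.ne').1 (hGi R hR)
  have hhm : Measurable h := measurable_of_countable _
  have hi2 : Integrable h Measure.count := by
    rw [← map_floorV, integrable_map_measure hhm.aestronglyMeasurable measurable_floorV.aemeasurable]
    exact hi1
  have e2 : ∫ u, h (floorV u) = ∑' z, h z := by
    rw [← integral_map (f := h) measurable_floorV.aemeasurable hhm.aestronglyMeasurable, map_floorV,
      integral_countable hi2]
    simp [Measure.real]
  rw [e1, e2]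

end

open MeasureTheory Filter Topology Set
open scoped RealInnerProductSpace Pointwise BigOperators
noncomputable section

/-- linear parametrization -/
def parL {d m : ℕ} (b : Fin m → Vd d) : (Fin m → ℝ) →ₗ[ℝ] Vd d := Fintype.linearCombination ℝ b

lemma parL_apply {d m : ℕ} (b : Fin m → Vd d) (t) : parL b t = ∑ i, t i • b i :=
  Fintype.linearCombination_apply ℝ b t

lemma parL_inj {d m : ℕ} {b : Fin m → Vd d} (hb : LinearIndependent ℝ b) :
    Function.Injective (parL b) :=
  linearIndependent_iff_injective_fintypeLinearCombination.1 hb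

lemma parL_range {d m : ℕ} (b : Fin m → Vd d) :
    LinearMap.range (parL b) = Submodule.span ℝ (Set.range b) :=
  Fintype.range_linearCombination ℝ b

lemma parL_cont {d m : ℕ} (b : Fin m → Vd d) : Continuous (parL b) :=
  (parL b).continuous_of_finiteDimensional

/-- integrand in coordinates -/
def gFun {d k m : ℕ} (w : Fin k → Vd d) (b : Fin m → Vd d) (ξ : Vd d) : (Fin m → ℝ) → ℝ :=
  (parL b ⁻¹' coneOf w).indicator fun t => Real.exp (pairE ξ (parL b t))

lemma coneOf_convex {d k : ℕ} (w : Fin k → Vd d) : Convex ℝ (coneOf w) := by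
  rintro x ⟨t, ht, rfl⟩ y ⟨u, hu, rfl⟩ α β hα hβ -
  refine ⟨fun i => α * t i + β * u i, fun i => by have := ht i; have := hu i; positivity, ?_⟩
  simp only [Finset.smul_sum, smul_smul, add_smul, Finset.sum_add_distrib]

lemma coneOf_smul_iff {d k : ℕ} (w : Fin k → Vd d) {r : ℝ} (hr : 0 < r) (x : Vd d) :
    r • x ∈ coneOf w ↔ x ∈ coneOf w := by
  have key : ∀ r : ℝ, 0 < r → ∀ x ∈ coneOf w, r • x ∈ coneOf w := by
    rintro r hr x ⟨t, ht, rfl⟩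
    refine ⟨fun i => r * t i, fun i => mul_nonneg hr.le (ht i), ?_⟩
    simp only [Finset.smul_sum, smul_smul]
  refine ⟨fun h => ?_, key r hr x⟩
  have := key r⁻¹ (inv_pos.2 hr) _ h
  rwa [smul_smul, inv_mul_cancel₀ hr.ne', one_smul] at this

lemma pairE_cont {d : ℕ} (ξ : Vd d) : Continuous (fun x => pairE ξ x) :=
  continuous_const.inner continuous_id

lemma gFun_measurable {d k m : ℕ} {w : Fin k → Vd d} (hcl : IsClosed (coneOf w))
    (b : Fin m → Vd d) (ξ : Vd d) : Measurable (gFun w b ξ) := by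
  refine Measurable.indicator ?_ (hcl.preimage (parL_cont b)).measurableSet
  exact (Real.continuous_exp.comp ((pairE_cont ξ).comp (parL_cont b))).measurable

lemma gFun_continuousAt {d k m : ℕ} (w : Fin k → Vd d)
    (b : Fin m → Vd d) (ξ : Vd d) : ∀ᵐ t, ContinuousAt (gFun w b ξ) t := by
  have hcv : Convex ℝ (parL b ⁻¹' coneOf w) := (coneOf_convex w).linear_preimage (parL b)
  have h0 := hcv.addHaar_frontier volume
  have hcont : Continuous fun t => Real.exp (pairE ξ (parL b t)) :=
    Real.continuous_exp.comp ((pairE_cont ξ).comp (parL_cont b))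
  filter_upwards [measure_eq_zero_iff_ae_notMem.1 h0] with t ht
  by_cases hi : t ∈ interior (parL b ⁻¹' coneOf w)
  · refine hcont.continuousAt.congr ?_
    filter_upwards [isOpen_interior.mem_nhds hi] with u hu
    unfold gFun
    rw [Set.indicator_of_mem (interior_subset hu)]
  · have hcl : t ∉ closure (parL b ⁻¹' coneOf w) := fun h => ht ⟨h, hi⟩
    refine (continuousAt_const (y := (0 : ℝ))).congr ?_
    filter_upwards [isClosed_closure.isOpen_compl.mem_nhds hcl] with u hu
    unfold gFun
    rw [Set.indicator_of_notMem (fun h => hu (subset_closure h))]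

lemma gFun_bound {d k m : ℕ} {w : Fin k → Vd d} {b : Fin m → Vd d}
    (hb : LinearIndependent ℝ b)
    (hs : Submodule.span ℝ (Set.range b) = Submodule.span ℝ (Set.range w)) {ξ : Vd d}
    (hξ : ξ ∈ negCone w) :
    ∃ a : ℝ, 0 < a ∧ ∀ t, |gFun w b ξ t| ≤ Real.exp (-a * ∑ i, |t i|) := by
  have h1 : ∀ j, ∃ τ : Fin m → ℝ, parL b τ = w j := by
    intro j
    have : w j ∈ LinearMap.range (parL b) := by
      rw [parL_range, hs]; exact Submodule.subset_span ⟨j, rfl⟩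
    exact this
  choose τ hτ using h1
  have h2 : ∀ᶠ a : ℝ in 𝓝[>] 0, ∀ j, a * ∑ i, |τ j i| ≤ - pairE ξ (w j) := by
    rw [eventually_all]
    intro j
    have : Tendsto (fun a : ℝ => a * ∑ i, |τ j i|) (𝓝[>] 0) (𝓝 0) := by
      have h : Tendsto (fun a : ℝ => a * ∑ i, |τ j i|) (𝓝 0) (𝓝 (0 * ∑ i, |τ j i|)) :=
        (continuous_id.mul continuous_const).tendsto 0
      rw [zero_mul] at h
      exact h.mono_left nhdsWithin_le_nhds
    exact this.eventually_le_const (by have := hξ j; linarith)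
  obtain ⟨a, ha, ha0⟩ := (h2.and self_mem_nhdsWithin).exists
  refine ⟨a, ha0, fun t => ?_⟩
  unfold gFun
  by_cases ht : t ∈ parL b ⁻¹' coneOf w
  · rw [Set.indicator_of_mem ht, abs_of_pos (Real.exp_pos _), Real.exp_le_exp]
    obtain ⟨u, hu, hx⟩ := ht
    have htu : t = ∑ j, u j • τ j := by
      apply parL_inj hb
      rw [hx, map_sum]
      simp only [map_smul, hτ]
    rw [hx, pairE_sum_right]
    simp only [pairE_smul_right]
    have h3 : ∑ i, |t i| ≤ ∑ j, u j * ∑ i, |τ j i| := by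
      calc ∑ i, |t i| ≤ ∑ i, ∑ j, u j * |τ j i| := by
            apply Finset.sum_le_sum
            intro i _
            rw [htu, Finset.sum_apply]
            refine (Finset.abs_sum_le_sum_abs _ _).trans (le_of_eq ?_)
            apply Finset.sum_congr rfl
            intro j _
            rw [Pi.smul_apply, smul_eq_mul, abs_mul, abs_of_nonneg (hu j)]
        _ = _ := by rw [Finset.sum_comm]; simp only [Finset.mul_sum]
    have h4 : a * ∑ j, u j * ∑ i, |τ j i| ≤ - ∑ j, u j * pairE ξ (w j) := by
      rw [Finset.mul_sum, ← Finset.sum_neg_distrib]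
      apply Finset.sum_le_sum
      intro j _
      have := mul_le_mul_of_nonneg_left (ha j) (hu j)
      linarith
    have h5 := mul_le_mul_of_nonneg_left h3 (le_of_lt (show 0 < a from ha0))
    linarith
  · rw [Set.indicator_of_notMem ht, abs_zero]; exact (Real.exp_pos _).le

lemma gFun_sum {d k m : ℕ} {Λ : AddSubgroup (Vd d)} {w : Fin k → Vd d} {b : Fin m → Vd d}
    (hb : LinearIndependent ℝ b) (hbΛ : ∀ i, b i ∈ Λ)
    (hs : Submodule.span ℝ (Set.range b) = Submodule.span ℝ (Set.range w))
    (hz : ∀ y ∈ Λ, y ∈ Submodule.span ℝ (Set.range b) →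
        ∃ c : Fin m → ℤ, y = ∑ i, (c i : ℝ) • b i) (ξ : Vd d) {R : ℝ} (hR : 0 < R) :
    ∑' z : Fin m → ℤ, gFun w b ξ (R⁻¹ • castV z) =
      ∑' x, (((fun x => 0 + x) '' coneOf w) ∩ (Λ : Set (Vd d))).indicator
        (fun x => Real.exp (pairE (R⁻¹ • ξ) x)) x := by
  have hset : ((fun x : Vd d => 0 + x) '' coneOf w) = coneOf w := by simp
  rw [hset]
  have hinj : Function.Injective fun z : Fin m → ℤ => parL b (castV z) := by
    intro z z' h
    have := parL_inj hb h
    funext i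
    have := congrFun this i
    exact_mod_cast (show (z i : ℝ) = z' i from this)
  rw [← hinj.tsum_eq]
  · congr 1
    funext z
    unfold gFun
    have hmem : parL b (castV z) ∈ Λ := by
      rw [parL_apply]
      refine AddSubgroup.sum_mem _ fun i _ => ?_
      show ((z i : ℝ)) • b i ∈ Λ
      rw [Int.cast_smul_eq_zsmul]
      exact AddSubgroup.zsmul_mem _ (hbΛ i) _
    by_cases h : parL b (castV z) ∈ coneOf w
    · rw [Set.indicator_of_mem, Set.indicator_of_mem (show _ ∈ coneOf w ∩ (Λ : Set (Vd d)) from ⟨h, hmem⟩)]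
      · rw [map_smul, pairE_smul_left, pairE_smul_right]
      · show parL b (R⁻¹ • castV z) ∈ coneOf w
        rw [map_smul, coneOf_smul_iff _ (inv_pos.2 hR)]; exact h
    · rw [Set.indicator_of_notMem, Set.indicator_of_notMem fun h' => h h'.1]
      show ¬ (parL b (R⁻¹ • castV z) ∈ coneOf w)
      rw [map_smul, coneOf_smul_iff _ (inv_pos.2 hR)]; exact h
  · intro x hx
    have hx' := Set.mem_of_indicator_ne_zero hx
    obtain ⟨⟨t, -, ht⟩, hxΛ⟩ := hx'
    have : x ∈ Submodule.span ℝ (Set.range b) := by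
      rw [hs, ht]
      exact Submodule.sum_mem _ fun i _ => Submodule.smul_mem _ _ (Submodule.subset_span ⟨i, rfl⟩)
    obtain ⟨c, hc⟩ := hz x hxΛ this
    exact ⟨c, by show parL b (castV c) = x; rw [parL_apply, hc]; rfl⟩

/-- the integral part -/
lemma integral_cone {d k : ℕ} {Λ : AddSubgroup (Vd d)} (hΛ : IsFullLattice Λ) (s : Vd d)
    {w : Fin k → Vd d} (hw : ∀ i, w i ∈ Λ) :
    ∃ (μ : Measure (Vd d)) (T : Vd d → ℝ),
      IsCanonicalMeasure Λ ((affineSpan ℝ ((fun x => s + x) '' coneOf w) :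
        AffineSubspace ℝ (Vd d)) : Set (Vd d)) μ ∧ AnalyticAt ℝ T 0 ∧
      ∀ ξ ∈ negCone w,
        IntegrableOn (fun x => Real.exp (pairE ξ x)) ((fun x => s + x) '' coneOf w) μ ∧
        (∏ i, pairE ξ (w i)) * ∫ x in (fun x => s + x) '' coneOf w, Real.exp (pairE ξ x) ∂μ
          = T ξ := by
  obtain ⟨m, b, hmk, hbΛ, hb, hspan, hz⟩ := exists_sublattice_basis hΛ hw
  obtain ⟨T, hT, hT'⟩ := good_analytic (good_cone hΛ 0 hw)
  obtain ⟨Q, hQ, hQ'⟩ := homog_limit hT (k - m)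
  have hcl := coneOf_isClosed hΛ hw
  have hφ : Continuous fun t : Fin m → ℝ => s + parL b t := continuous_const.add (parL_cont b)
  have hPcl : IsClosed ((fun x => s + x) '' coneOf w) :=
    (Homeomorph.addLeft s).isClosedMap _ hcl
  have hpre : (fun t : Fin m → ℝ => s + parL b t) ⁻¹' ((fun x => s + x) '' coneOf w) =
      parL b ⁻¹' coneOf w := by
    ext t; simp
  have hc'meas : MeasurableSet (parL b ⁻¹' coneOf w) := (hcl.preimage (parL_cont b)).measurableSet
  refine ⟨Measure.map (fun t : Fin m → ℝ => s + parL b t) volume,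
    fun ξ => Real.exp (pairE ξ s) * Q ξ, ?_, (analyticAt_expE s 0).mul hQ, ?_⟩
  · refine ⟨m, s, b, ?_, hbΛ, hb, ?_, hz, ?_⟩
    · rw [affineSpan_translate_cone]
      exact ⟨0, Submodule.zero_mem _, by simp⟩
    · rw [affineSpan_translate_cone, ← hspan, ← parL_range]
      ext x
      constructor
      · rintro ⟨_, ⟨t, rfl⟩, rfl⟩
        exact ⟨t, by simp only [parL_apply]⟩
      · rintro ⟨t, rfl⟩
        exact ⟨_, ⟨t, rfl⟩, by simp only [parL_apply]⟩
    · simp only [parL_apply]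
  · intro ξ hξ
    obtain ⟨a, ha, hbd⟩ := gFun_bound hb hspan hξ
    have hgm := gFun_measurable hcl b ξ
    have hgi : Integrable (gFun w b ξ) :=
      (integrable_prod_exp ha).mono' hgm.aestronglyMeasurable (Eventually.of_forall hbd)
    have hexpm : Measurable fun x => Real.exp (pairE ξ x) :=
      (Real.continuous_exp.comp (pairE_cont ξ)).measurable
    have hgi' : IntegrableOn (fun t => Real.exp (pairE ξ (parL b t))) (parL b ⁻¹' coneOf w) :=
      (integrable_indicator_iff hc'meas).1 hgi
    have hR := riemann_sum hgm ha hbd (gFun_continuousAt w b ξ)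
    have hlim : Tendsto (fun R : ℝ => R ^ (k - m) * T (R⁻¹ • ξ)) atTop
        (𝓝 ((∏ i, pairE ξ (w i)) * ∫ t, gFun w b ξ t)) := by
      refine (hR.const_mul (∏ i, pairE ξ (w i))).congr' ?_
      filter_upwards [eventually_gt_atTop 0] with R hR0
      have hmem : R⁻¹ • ξ ∈ negCone w := fun i => by
        rw [pairE_smul_left]; exact mul_neg_of_pos_of_neg (inv_pos.2 hR0) (hξ i)
      rw [← (hT' _ hmem).2, gFun_sum hb hbΛ hspan hz ξ hR0]
      simp only [pairE_smul_left, Finset.prod_mul_distrib, Finset.prod_const, Finset.card_univ,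
        Fintype.card_fin]
      rw [pow_sub₀ _ hR0.ne' hmk, inv_pow]
      have : R ^ k ≠ 0 := pow_ne_zero _ hR0.ne'
      field_simp
    have hQξ := hQ' ξ _ hlim
    have hsplit : ∀ t, Real.exp (pairE ξ (s + parL b t)) =
        Real.exp (pairE ξ s) * Real.exp (pairE ξ (parL b t)) := by
      intro t; rw [pairE_add_right, Real.exp_add]
    constructor
    · rw [IntegrableOn, Measure.restrict_map hφ.measurable hPcl.measurableSet, hpre,
        integrable_map_measure hexpm.aestronglyMeasurable hφ.measurable.aemeasurable]
      have := hgi'.const_mul (Real.exp (pairE ξ s))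
      refine this.congr (Eventually.of_forall fun t => ?_)
      exact (hsplit t).symm
    · rw [setIntegral_map hPcl.measurableSet hexpm.aestronglyMeasurable hφ.measurable.aemeasurable,
        hpre]
      simp only [hsplit]
      rw [integral_const_mul, ← hQξ, ← integral_indicator hc'meas]
      simp only [gFun]
      ring

end

open MeasureTheory Filter Topology Set
open scoped RealInnerProductSpace Pointwise BigOperators
noncomputable section

lemma coneOf_scale {d k : ℕ} (v : Fin k → Vd d) (r : Fin k → ℝ) (hr : ∀ i, 0 < r i) :
    coneOf (fun i => r i • v i) = coneOf v := by
  ext x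
  constructor
  · rintro ⟨t, ht, rfl⟩
    exact ⟨fun i => t i * r i, fun i => mul_nonneg (ht i) (hr i).le, by simp only [smul_smul]⟩
  · rintro ⟨t, ht, rfl⟩
    refine ⟨fun i => t i / r i, fun i => div_nonneg (ht i) (hr i).le, ?_⟩
    apply Finset.sum_congr rfl
    intro i _
    rw [smul_smul, div_mul_cancel₀ _ (hr i).ne']

lemma main_aux {d : ℕ} {Λ : AddSubgroup (Vd d)} (hΛ : IsFullLattice Λ)
    (I S : Set (Vd d) → Vd d → ℝ) (hI : IsIMap Λ I) (hS : IsSMap Λ S)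
    (s : Vd d) (hs : IsRatPoint Λ s)
    (k : ℕ) (v : Fin k → Vd d) (hvrat : ∀ i, IsRatPoint Λ (v i))
    (hp : ¬ ContainsLine ((fun x => s + x) '' coneOf v)) :
    (∃ g : Vd d → ℝ, AnalyticAt ℝ g 0 ∧
      MeroEqAt0 (fun ξ => (∏ i, pairE ξ (v i)) * I ((fun x => s + x) '' coneOf v) ξ) g) ∧
    (∃ g : Vd d → ℝ, AnalyticAt ℝ g 0 ∧
      MeroEqAt0 (fun ξ => (∏ i, pairE ξ (v i)) * S ((fun x => s + x) '' coneOf v) ξ) g) := by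
  by_cases hv0 : ∃ i, v i = 0
  · obtain ⟨i, hi⟩ := hv0
    have hz : ∀ ξ : Vd d, ∏ i, pairE ξ (v i) = 0 := fun ξ =>
      Finset.prod_eq_zero (Finset.mem_univ i) (by rw [hi, pairE_zero_right])
    constructor <;>
    · refine ⟨fun _ => 0, analyticAt_const, ∅, isClosed_empty, interior_empty, ?_⟩
      exact Eventually.of_forall fun ξ _ => by beta_reduce; rw [hz, zero_mul]
  push Not at hv0
  choose q hq0 hq using hvrat
  have hr : ∀ i, 0 < |(q i : ℝ)| := fun i => abs_pos.2 (by exact_mod_cast hq0 i)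
  obtain ⟨w, hwdef⟩ : ∃ w : Fin k → Vd d, w = fun i => |(q i : ℝ)| • v i := ⟨_, rfl⟩
  have hwv : coneOf w = coneOf v := by rw [hwdef]; exact coneOf_scale v _ hr
  have hw : ∀ i, w i ∈ Λ := by
    intro i
    rw [hwdef]
    rcases abs_choice (q i : ℝ) with h | h
    · show |(q i : ℝ)| • v i ∈ Λ
      rw [h]; exact hq i
    · show |(q i : ℝ)| • v i ∈ Λ
      rw [h, neg_smul]; exact AddSubgroup.neg_mem _ (hq i)
  have hw0 : ∀ i, w i ≠ 0 := by
    intro i; rw [hwdef]; exact smul_ne_zero (hr i).ne' (hv0 i)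
  have hc0 : ∏ i, |(q i : ℝ)| ≠ 0 := Finset.prod_ne_zero_iff.2 fun i _ => (hr i).ne'
  have hprod : ∀ ξ, ∏ i, pairE ξ (v i) = (∏ i, |(q i : ℝ)|)⁻¹ * ∏ i, pairE ξ (w i) := by
    intro ξ
    rw [hwdef]
    simp only [pairE_smul_right, Finset.prod_mul_distrib]
    rw [inv_mul_cancel_left₀ hc0]
  have hpan : AnalyticAt ℝ (fun ξ : Vd d => ∏ i, pairE ξ (v i)) 0 :=
    Finset.analyticAt_fun_prod _ fun i _ => analyticAt_pairE (v i) 0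
  rw [← hwv] at hp ⊢
  have hpoly := translate_ratPolyhedron hΛ hs hw
  have hne := negCone_nonempty w hw0 s hp
  have hcl := zero_mem_closure_negCone w hne
  constructor
  · obtain ⟨μ, T, hμ, hT, hT'⟩ := integral_cone hΛ s hw
    refine ⟨fun ξ => (∏ i, |(q i : ℝ)|)⁻¹ * T ξ, analyticAt_const.mul hT,
      mero_conclude (hI.1 _ hpoly) (analyticAt_const.mul hT) hpan (negCone_isOpen w) hcl ?_⟩
    intro ξ hξ
    obtain ⟨h1, h2⟩ := hT' ξ hξ
    rw [hI.2.2 _ hpoly μ hμ ξ h1, hprod, mul_assoc, h2]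
  · obtain ⟨T, hT, hT'⟩ := good_analytic (good_cone hΛ s hw)
    refine ⟨fun ξ => (∏ i, |(q i : ℝ)|)⁻¹ * T ξ, analyticAt_const.mul hT,
      mero_conclude (hS.1 _ hpoly) (analyticAt_const.mul hT) hpan (negCone_isOpen w) hcl ?_⟩
    intro ξ hξ
    obtain ⟨h1, h2⟩ := hT' ξ hξ
    rw [hS.2.2 _ hpoly ξ (summable_subtype_iff_indicator.2 h1), hprod, mul_assoc, ← h2]
    rw [tsum_subtype (((fun x => s + x) '' coneOf w) ∩ (Λ : Set (Vd d)))
      (fun x => Real.exp (pairE ξ x))]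

end

/-- for a pointed rational affine cone `a = s + c` with rational vertex `s` and
rational generators `v₁,…,v_k` of the edges of `c`, the products
`(∏ᵢ ⟨ξ,vᵢ⟩)·I(a)(ξ)` and `(∏ᵢ ⟨ξ,vᵢ⟩)·S(a)(ξ)` are analytic near `0`. -/
theorem statement5 (d : ℕ) (Λ : AddSubgroup (Vd d)) (hΛ : IsFullLattice Λ)
    (I S : Set (Vd d) → Vd d → ℝ) (hI : IsIMap Λ I) (hS : IsSMap Λ S)
    (s : Vd d) (hs : IsRatPoint Λ s)
    (k : ℕ) (v : Fin k → Vd d) (hvrat : ∀ i, IsRatPoint Λ (v i))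
    (hedges : ∀ i, IsFaceOf {x | ∃ t : Fin k → ℝ, (∀ j, 0 ≤ t j) ∧ x = ∑ j, t j • v j}
      {x | ∃ r : ℝ, 0 ≤ r ∧ x = r • v i})
    (hpointed :
      ¬ ContainsLine ((fun x => s + x) ''
        {x | ∃ t : Fin k → ℝ, (∀ j, 0 ≤ t j) ∧ x = ∑ j, t j • v j})) :
    (∃ g : Vd d → ℝ, AnalyticAt ℝ g 0 ∧
      MeroEqAt0
        (fun ξ => (∏ i, pairE ξ (v i)) *
          I ((fun x => s + x) '' {x | ∃ t : Fin k → ℝ, (∀ j, 0 ≤ t j) ∧ x = ∑ j, t j • v j}) ξ)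
        g) ∧
    (∃ g : Vd d → ℝ, AnalyticAt ℝ g 0 ∧
      MeroEqAt0
        (fun ξ => (∏ i, pairE ξ (v i)) *
          S ((fun x => s + x) '' {x | ∃ t : Fin k → ℝ, (∀ j, 0 ≤ t j) ∧ x = ∑ j, t j • v j}) ξ)
        g) := by
  exact main_aux hΛ I S hI hS s hs k v hvrat hpointed
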